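/- arXiv:2202.06734 — 2 statements merged into one kernel-verified Lean document; each statement's English description precedes it below -/
import Mathlib

section
/- A symmetric pair of chords {c, −c} is the comajor pair of some cubic symmetric lamination if and only if it is a legal pair. In particular, every legal pair {c, −c} is the comajor pair of a cubic symmetric lamination. -/
noncomputable section

open Set Metric

instance : Fact ((0:ℝ) < 1) := ⟨one_pos⟩

/-- The circle `S = ℝ/ℤ`. -/
abbrev S1 : Type := AddCircle (1 : ℝ)

/-- The tripling map `σ₃ : x ↦ 3x (mod 1)`. -/
def s3 : S1 → S1 := fun x => (3 : ℕ) • x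

/-- The antipodal map `x ↦ x + 1/2` (denoted `−x` in the paper). -/
def antip : S1 → S1 := fun x => x + (((1:ℝ)/2 : ℝ) : S1)

/-- A chord of the circle: an unordered pair of points of `S1`. -/
abbrev Chord : Type := Sym2 S1

/-- The image chord of a chord under a circle map. -/
def cmap (f : S1 → S1) (ℓ : Chord) : Chord := Sym2.map f ℓ

/-- The length of a chord `{a,b}`: the shorter of the two arcs joining `a` and `b`
(the natural norm on `ℝ/ℤ`). -/
def chordLen : Chord → ℝ :=
  Sym2.lift ⟨fun a b => ‖a - b‖, fun a b => norm_sub_rev a b⟩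

/-- The standard embedding of the circle `ℝ/ℤ` into `ℂ` (onto the unit circle). -/
def toC (x : S1) : ℂ :=
  Complex.exp (2 * Real.pi * Complex.I * (((AddCircle.equivIco 1 0 x : Set.Ico (0:ℝ) (0+1)) : ℝ) : ℂ))

/-- The geometric chord in the closed unit disk of `ℂ` determined by an
unordered pair of circle points. -/
def chordSet : Chord → Set ℂ :=
  Sym2.lift ⟨fun a b => segment ℝ (toC a) (toC b), fun a b => segment_symm ℝ _ _⟩

/-- Two chords cross if their endpoints strictly alternate on the circle. -/
def Crosses (ℓ₁ ℓ₂ : Chord) : Prop :=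
  (∃ a b c d : ℝ, a < b ∧ b < c ∧ c < d ∧ d < a + 1 ∧
    ℓ₁ = s(((a : ℝ) : S1), ((c : ℝ) : S1)) ∧ ℓ₂ = s(((b : ℝ) : S1), ((d : ℝ) : S1))) ∨
  (∃ a b c d : ℝ, a < b ∧ b < c ∧ c < d ∧ d < a + 1 ∧
    ℓ₂ = s(((a : ℝ) : S1), ((c : ℝ) : S1)) ∧ ℓ₁ = s(((b : ℝ) : S1), ((d : ℝ) : S1)))

/-- A critical chord: nondegenerate with degenerate `σ₃`-image. -/
def IsCritical (ℓ : Chord) : Prop := ¬ ℓ.IsDiag ∧ (cmap s3 ℓ).IsDiag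

/-- The union in `ℂ` of all the chords of a family. -/
def unionSet (L : Set Chord) : Set ℂ := ⋃ ℓ ∈ L, chordSet ℓ

def openDisk : Set ℂ := Metric.ball (0:ℂ) 1
def closedDisk : Set ℂ := Metric.closedBall (0:ℂ) 1

/-- A lamination: a family of pairwise non-crossing chords whose union is closed. -/
structure IsLamination (L : Set Chord) : Prop where
  nocross : ∀ ℓ₁ ∈ L, ∀ ℓ₂ ∈ L, ¬ Crosses ℓ₁ ℓ₂
  closed : IsClosed (unionSet L)

/-- A sibling collection: three pairwise disjoint chords with the same
nondegenerate `σ₃`-image. -/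
def IsSiblingCollection (ℓ₁ ℓ₂ ℓ₃ : Chord) : Prop :=
  Disjoint (chordSet ℓ₁) (chordSet ℓ₂) ∧ Disjoint (chordSet ℓ₁) (chordSet ℓ₃) ∧
  Disjoint (chordSet ℓ₂) (chordSet ℓ₃) ∧
  ¬ (cmap s3 ℓ₁).IsDiag ∧ cmap s3 ℓ₂ = cmap s3 ℓ₁ ∧ cmap s3 ℓ₃ = cmap s3 ℓ₁

/-- A `σ₃`-invariant lamination. -/
structure IsInvLam (L : Set Chord) extends IsLamination L : Prop where
  forward : ∀ ℓ ∈ L, cmap s3 ℓ ∈ L ∨ (cmap s3 ℓ).IsDiag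
  backward : ∀ ℓ ∈ L, ∃ ℓ' ∈ L, cmap s3 ℓ' = ℓ
  siblings : ∀ ℓ ∈ L, ¬ (cmap s3 ℓ).IsDiag →
    ∃ ℓ₂ ∈ L, ∃ ℓ₃ ∈ L, IsSiblingCollection ℓ ℓ₂ ℓ₃

/-- A cubic symmetric lamination. -/
structure IsCubicSymLam (L : Set Chord) extends IsInvLam L : Prop where
  symm : ∀ ℓ ∈ L, cmap antip ℓ ∈ L

/-- A major: a leaf whose length is closest to `1/3` among all leaves. -/
def IsMajor (L : Set Chord) (M : Chord) : Prop :=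
  M ∈ L ∧ ∀ ℓ ∈ L, |1/3 - chordLen M| ≤ |1/3 - chordLen ℓ|

/-- A minor: the `σ₃`-image of a major. -/
def IsMinor (L : Set Chord) (m : Chord) : Prop := ∃ M, IsMajor L M ∧ m = cmap s3 M

/-- A comajor: a short (or degenerate) sibling of a major, disjoint from all majors. -/
def IsComajor (L : Set Chord) (c : Chord) : Prop :=
  (chordLen c < 1/6 ∨ c.IsDiag) ∧ (¬ c.IsDiag → c ∈ L) ∧
  (∃ M, IsMajor L M ∧ cmap s3 c = cmap s3 M) ∧
  (∀ M, IsMajor L M → Disjoint (chordSet c) (chordSet M))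

/-- The cubic symmetric comajor lamination: all comajors of all cubic symmetric
laminations. -/
def CsCL : Set Chord := {c | ∃ L, IsCubicSymLam L ∧ IsComajor L c}

/-- A chord is periodic if some positive iterate of `σ₃` fixes it. -/
def ChordPeriodic (c : Chord) : Prop := ∃ p, 1 ≤ p ∧ cmap (s3^[p]) c = c

/-- A comajor is co-periodic if its image is periodic but it is not. -/
def CoPeriodic (c : Chord) : Prop := ChordPeriodic (cmap s3 c) ∧ ¬ ChordPeriodic c

/-- The point of the unit circle in `ℂ` with argument `2πt`. -/
def circPt (t : ℝ) : ℂ := toC ((t : ℝ) : S1)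

/-- The (closed) arc of the circle in `ℂ` from angle `u` to angle `v` (traversed
positively), as a subset of `ℂ`. -/
def arcSet (u v : ℝ) : Set ℂ := circPt '' Set.Icc u v

/-- The unordered arc between angles `u` and `v`. -/
def arcSetU (u v : ℝ) : Set ℂ := circPt '' Set.uIcc u v

/-- The closed region `R(n)` bounded by the chord from angle `a` to angle `a+t`
(with `t` the length of the chord) and the corresponding (shorter) arc `H(n)`:
the convex hull of that arc. -/
def regionUnder (a t : ℝ) : Set ℂ := convexHull ℝ (arcSet a (a + t))

/-- `Under m n` (`m ≺ n`): `m` is contained in the region `R(n)`. -/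
def Under (m n : Chord) : Prop :=
  ∃ a t : ℝ, 0 ≤ t ∧ t < 1/2 ∧ t = chordLen n ∧
    n = s(((a : ℝ) : S1), ((a + t : ℝ) : S1)) ∧ chordSet m ⊆ regionUnder a t

/-- The (closed) strip `C(ℓ)` between the medium/long chord `ℓ` from angle `a` to
angle `a+t` (with `1/6 < t ≤ 1/2` its length) and its medium/long sibling
`ℓ' = {a+1/3, a+t-1/3}`. -/
def stripSet (a t : ℝ) : Set ℂ :=
  convexHull ℝ (arcSetU (a + t) (a + 1/3) ∪ arcSetU (a + t - 1/3) a)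

/-- The short strips `SH(ℓ) = C(ℓ) ∪ −C(ℓ)`. -/
def SHSet (a t : ℝ) : Set ℂ := stripSet a t ∪ stripSet (a + 1/2) t

/-- For a short chord `c` from angle `a` to angle `a+t` (`0 ≤ t < 1/6`), the strip
`C(M_c)` between the two medium/long chords `M_c = {a+2/3, a+t+1/3}` and
`M'_c = {a+1/3, a+t+2/3}` having the same `σ₃`-image as `c`. -/
def QStrip (a t : ℝ) : Set ℂ :=
  convexHull ℝ (arcSet (a + 1/3) (a + t + 1/3) ∪ arcSet (a + 2/3) (a + t + 2/3))

/-- A legal (symmetric) pair `{c, −c}`. -/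
def IsLegalPair (c : Chord) : Prop :=
  c.IsDiag ∨
  ∃ a t : ℝ, 0 < t ∧ t < 1/6 ∧ t = chordLen c ∧
    c = s(((a : ℝ) : S1), ((a + t : ℝ) : S1)) ∧
    (∀ i j : ℕ,
      ¬ Crosses (cmap (s3^[i]) c) (cmap (s3^[j]) c) ∧
      ¬ Crosses (cmap (s3^[i]) c) (cmap (s3^[j]) (cmap antip c)) ∧
      ¬ Crosses (cmap (s3^[i]) (cmap antip c)) (cmap (s3^[j]) (cmap antip c))) ∧
    (∀ i : ℕ, 1 ≤ i →
      chordSet (cmap (s3^[i]) c) ∩ interior (QStrip a t ∪ QStrip (a + 1/2) t) = ∅)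

/-- A gap of a lamination: the closure of a connected component of the complement,
in the open unit disk, of the union of the leaves. -/
def IsGapOf (L : Set Chord) (G : Set ℂ) : Prop :=
  ∃ z ∈ openDisk \ unionSet L, G = closure (connectedComponentIn (openDisk \ unionSet L) z)

/-- The vertices of a gap: its points on the circle. -/
def gapVerts (G : Set ℂ) : Set S1 := {x : S1 | toC x ∈ G}

/-- The image of a gap: the convex hull of the `σ₃`-image of its vertex set. -/
def gapImage (G : Set ℂ) : Set ℂ := convexHull ℝ (toC '' (s3 '' gapVerts G))

/-- Iterated gap images. -/
def gapIter (n : ℕ) (G : Set ℂ) : Set ℂ := gapImage^[n] G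

/-- An edge of a gap: a nondegenerate chord contained in its boundary. -/
def IsEdgeOf (G : Set ℂ) (ℓ : Chord) : Prop := ¬ ℓ.IsDiag ∧ chordSet ℓ ⊆ frontier G

/-- The (first return) map `σ₃^p` on the gap `G` has degree greater than one:
some edge of the image gap has (at least) two disjoint preimage edges in `G`. -/
def GapDegreeGE2 (G : Set ℂ) (p : ℕ) : Prop :=
  ∃ m e₁ e₂ : Chord, IsEdgeOf (gapIter p G) m ∧ e₁ ≠ e₂ ∧
    IsEdgeOf G e₁ ∧ IsEdgeOf G e₂ ∧ Disjoint (chordSet e₁) (chordSet e₂) ∧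
    cmap (s3^[p]) e₁ = m ∧ cmap (s3^[p]) e₂ = m

/-- `L` has a periodic infinite gap of degree greater than one (hyperbolicity). -/
def HasHyperbolicGap (L : Set Chord) : Prop :=
  ∃ G p, IsGapOf L G ∧ (gapVerts G).Infinite ∧ 1 ≤ p ∧ gapIter p G = G ∧ GapDegreeGE2 G p

/-- Two circle points are joined by a finite concatenation of leaves of `L`. -/
def ChainJoined (L : Set Chord) : S1 → S1 → Prop :=
  Relation.ReflTransGen (fun x y => ∃ ℓ ∈ L, x ∈ ℓ ∧ y ∈ ℓ)

/-- A q-lamination: points joined by finite concatenations of leaves are vertices of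
a single leaf or finite gap. -/
def IsQLam (L : Set Chord) : Prop :=
  ∀ x y : S1, ChainJoined L x y →
    x = y ∨ (∃ ℓ ∈ L, x ∈ ℓ ∧ y ∈ ℓ) ∨
    (∃ G, IsGapOf L G ∧ (gapVerts G).Finite ∧ toC x ∈ G ∧ toC y ∈ G)

/-- A periodic point of `σ₃`. -/
def PerPt (x : S1) : Prop := ∃ p, 1 ≤ p ∧ s3^[p] x = x

/-- An eventually periodic point of `σ₃`. -/
def EvPerPt (x : S1) : Prop := ∃ k, PerPt (s3^[k] x)

/-- `x` is strictly preperiodic of preperiod `k ≥ 1` and period `p`. -/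
def StrictPreper (x : S1) (k p : ℕ) : Prop :=
  1 ≤ k ∧ 1 ≤ p ∧ s3^[p] (s3^[k] x) = s3^[k] x ∧
  (∀ j < k, ¬ PerPt (s3^[j] x)) ∧
  (∀ q, 1 ≤ q → s3^[q] (s3^[k] x) = s3^[k] x → p ≤ q)

/-- A periodic point of type B: of period `2n` with `σ₃ⁿ(x) = −x`. -/
def TypeB (x : S1) : Prop :=
  ∃ n, 1 ≤ n ∧ Function.minimalPeriod s3 x = 2 * n ∧ s3^[n] x = antip x

/-- `c` is a two-sided limit of chords of the family `A`: within every complementary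
component of the disk minus `c` there are chords of `A` converging to `c`. -/
def TwoSidedLimitOf (A : Set Chord) (c : Chord) : Prop :=
  ∀ z ∈ closedDisk \ chordSet c, ∀ ε : ℝ, 0 < ε →
    ∃ d ∈ A, d ≠ c ∧ chordSet d ⊆ connectedComponentIn (closedDisk \ chordSet c) z ∧
      Metric.hausdorffDist (chordSet d) (chordSet c) < ε

/-- The chord `n` weakly separates the chords `ℓ₁` and `ℓ₂`. -/
def WeaklySep (n ℓ₁ ℓ₂ : Chord) : Prop :=
  ∃ z₁ ∈ chordSet ℓ₁ \ chordSet n, ∃ z₂ ∈ chordSet ℓ₂ \ chordSet n,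
    chordSet ℓ₁ \ chordSet n ⊆ connectedComponentIn (closedDisk \ chordSet n) z₁ ∧
    chordSet ℓ₂ \ chordSet n ⊆ connectedComponentIn (closedDisk \ chordSet n) z₂ ∧
    connectedComponentIn (closedDisk \ chordSet n) z₁ ≠
      connectedComponentIn (closedDisk \ chordSet n) z₂

/-- The (non-diameter, non-fixed) chord `ℓ` moves in under the circle map `h`. -/
def MovesIn (h : S1 → S1) (ℓ : Chord) : Prop := cmap h ℓ ≠ ℓ ∧ Under (cmap h ℓ) ℓ

/-- The chord `ℓ` moves out under the circle map `h`. -/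
def MovesOut (h : S1 → S1) (ℓ : Chord) : Prop := cmap h ℓ ≠ ℓ ∧ ¬ Under (cmap h ℓ) ℓ

/-! ### Coordinates on the circle -/

lemma s3_coe (x : ℝ) : s3 (x : S1) = ((3 * x : ℝ) : S1) := by
  simp [s3, ← AddCircle.coe_nsmul]

lemma antip_coe (x : ℝ) : antip (x : S1) = ((x + 1 / 2 : ℝ) : S1) := by
  simp [antip]

lemma coe_add_int (x : ℝ) (n : ℤ) : ((x + n : ℝ) : S1) = x := by
  rw [AddCircle.coe_add]
  have : ((n : ℝ) : S1) = 0 := (AddCircle.coe_eq_zero_iff 1).2 ⟨n, by simp⟩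
  rw [this, add_zero]

lemma coe_eq_coe {x y : ℝ} (n : ℤ) (h : x = y + n) : (x : S1) = y := by
  rw [h, coe_add_int]

lemma exists_int_of_coe_eq {x y : ℝ} (h : (x : S1) = y) : ∃ n : ℤ, x = y + n := by
  have h0 : ((x - y : ℝ) : S1) = 0 := by rw [AddCircle.coe_sub, h, sub_self]
  obtain ⟨n, hn⟩ := (AddCircle.coe_eq_zero_iff 1).1 h0
  exact ⟨n, by simp at hn; linarith⟩

lemma exists_lift (m p : ℝ) (x : S1) : ∃ θ : ℝ, p ≤ θ ∧ θ < p + 1 ∧ ((m + θ : ℝ) : S1) = x := by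
  have hx : x ∈ ((↑) : ℝ → S1) '' Ico (m + p) (m + p + 1) := by
    rw [AddCircle.coe_image_Ico_eq]; trivial
  obtain ⟨y, ⟨h1, h2⟩, rfl⟩ := hx
  exact ⟨y - m, by linarith, by linarith, by congr 1; ring⟩

lemma s3_antip (x : S1) : s3 (antip x) = antip (s3 x) := by
  obtain ⟨x, -, -, rfl⟩ := exists_lift 0 0 x
  rw [antip_coe, s3_coe, s3_coe, antip_coe]
  exact coe_eq_coe 1 (by push_cast; ring)

lemma antip_antip (x : S1) : antip (antip x) = x := by
  obtain ⟨x, -, -, rfl⟩ := exists_lift 0 0 x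
  rw [antip_coe, antip_coe]
  exact coe_eq_coe 1 (by push_cast; ring)

lemma s3_iterate_antip (n : ℕ) (x : S1) : s3^[n] (antip x) = antip (s3^[n] x) :=
  (Function.Commute.iterate_left (f := s3) (g := antip) (fun x => s3_antip x) n) x

lemma toC_coe (x : ℝ) :
    toC (x : S1) = Complex.exp (2 * Real.pi * Complex.I * (x : ℂ)) := by
  unfold toC
  have h : (((AddCircle.equivIco 1 0 (x : S1) : Set.Ico (0:ℝ) (0+1)) : ℝ) : S1) = x :=
    AddCircle.coe_equivIco
  obtain ⟨n, hn⟩ := exists_int_of_coe_eq h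
  rw [hn, Complex.exp_eq_exp_iff_exists_int]
  exact ⟨n, by push_cast; ring⟩

lemma toC_coe_re (x : ℝ) : (toC (x : S1)).re = Real.cos (2 * Real.pi * x) := by
  rw [toC_coe, show (2 * Real.pi * Complex.I * (x : ℂ)) = ((2 * Real.pi * x : ℝ) : ℂ) * Complex.I by
    push_cast; ring, Complex.exp_ofReal_mul_I_re]

lemma toC_coe_im (x : ℝ) : (toC (x : S1)).im = Real.sin (2 * Real.pi * x) := by
  rw [toC_coe, show (2 * Real.pi * Complex.I * (x : ℂ)) = ((2 * Real.pi * x : ℝ) : ℂ) * Complex.I by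
    push_cast; ring, Complex.exp_ofReal_mul_I_im]

lemma continuous_toC : Continuous toC := by
  refine continuous_quot_lift (r := QuotientAddGroup.leftRel (AddSubgroup.zmultiples (1:ℝ)))
    (f := fun x : ℝ => Complex.exp (2 * Real.pi * Complex.I * (x : ℂ))) ?_ (by fun_prop)
    |>.congr ?_
  · intro a b hab
    have : (a : S1) = b := Quotient.sound hab
    simp only [← toC_coe, this]
  · intro x
    obtain ⟨x, -, -, rfl⟩ := exists_lift 0 0 x
    exact (toC_coe _).symm

lemma toC_antip (x : S1) : toC (antip x) = - toC x := by
  obtain ⟨x, -, -, rfl⟩ := exists_lift 0 0 x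
  rw [antip_coe, Complex.ext_iff, Complex.neg_re, Complex.neg_im, toC_coe_re, toC_coe_im,
    toC_coe_re, toC_coe_im, show 2 * Real.pi * (0 + x + 1 / 2) = 2 * Real.pi * (0 + x) + Real.pi by
      ring, Real.cos_add_pi, Real.sin_add_pi]
  exact ⟨rfl, rfl⟩

lemma cmap_mk (f : S1 → S1) (x y : S1) : cmap f s(x, y) = s(f x, f y) := rfl

lemma chordLen_mk (x y : S1) : chordLen s(x, y) = ‖x - y‖ := rfl

lemma chordSet_mk (x y : S1) : chordSet s(x, y) = segment ℝ (toC x) (toC y) := rfl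

lemma chordSet_antip (ℓ : Chord) : chordSet (cmap antip ℓ) = -chordSet ℓ := by
  induction ℓ using Sym2.ind with
  | _ x y =>
    rw [cmap_mk, chordSet_mk, chordSet_mk, toC_antip, toC_antip]
    ext z
    simp only [segment, mem_ofPred_eq, Set.mem_neg]
    constructor
    · rintro ⟨p, q, hp, hq, hpq, rfl⟩
      exact ⟨p, q, hp, hq, hpq, by simp; ring⟩
    · rintro ⟨p, q, hp, hq, hpq, h⟩
      exact ⟨p, q, hp, hq, hpq, by rw [← neg_neg z, ← h]; simp; ring⟩

lemma chordLen_antip (ℓ : Chord) : chordLen (cmap antip ℓ) = chordLen ℓ := by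
  induction ℓ using Sym2.ind with
  | _ x y => simp [cmap_mk, chordLen_mk, antip]

lemma cmap_antip_antip (ℓ : Chord) : cmap antip (cmap antip ℓ) = ℓ := by
  induction ℓ using Sym2.ind with
  | _ x y => simp [cmap_mk, antip_antip]

lemma isDiag_antip (ℓ : Chord) : (cmap antip ℓ).IsDiag ↔ ℓ.IsDiag := by
  induction ℓ using Sym2.ind with
  | _ x y => simp [cmap_mk, antip]

lemma cmap_s3_antip (ℓ : Chord) : cmap s3 (cmap antip ℓ) = cmap antip (cmap s3 ℓ) := by
  induction ℓ using Sym2.ind with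
  | _ x y => simp [cmap_mk, s3_antip]

lemma norm_coe_of_abs_le {x : ℝ} (h : |x| ≤ 1 / 2) : ‖(x : S1)‖ = |x| :=
  (AddCircle.norm_coe_eq_abs_iff 1 one_ne_zero).2 (by simpa using h)

lemma norm_coe_of_nonneg {x : ℝ} (h0 : 0 ≤ x) (h : x ≤ 1 / 2) : ‖(x : S1)‖ = x := by
  rw [norm_coe_of_abs_le (by rwa [abs_of_nonneg h0]), abs_of_nonneg h0]

lemma norm_coe_of_half_le {x : ℝ} (h0 : 1 / 2 ≤ x) (h : x ≤ 1) : ‖(x : S1)‖ = 1 - x := by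
  rw [← norm_neg, ← AddCircle.coe_neg, coe_eq_coe (x := -x) (y := 1 - x) (-1) (by push_cast; ring)]
  exact norm_coe_of_nonneg (by linarith) (by linarith)

/-! ### The crossing form -/

/-- The form whose sign decides whether the chords `{x, y}` and `{u, v}` cross. -/
def crossForm (x y u v : S1) : ℝ :=
  (toC (x - y)).re + (toC (u - v)).re - (toC (x - u)).re - (toC (y - v)).re - (toC (x - v)).re
    - (toC (y - u)).re + 1 + (toC (x + y - u - v)).re

lemma trig_identity (p q r : ℝ) :
    Real.cos (2 * (p - r)) + Real.cos (2 * (q - p)) - Real.cos (2 * p)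
      - Real.cos (2 * (q + r - p)) - Real.cos (2 * q) - Real.cos (2 * r) + 1
      + Real.cos (2 * (q + r))
    = 8 * (Real.sin p * Real.sin q * Real.sin r * Real.sin (q + r - p)) := by
  have key : ∀ A B : ℝ, 2 * (Real.sin A * Real.sin B) = Real.cos (A - B) - Real.cos (A + B) := by
    intro A B; rw [Real.cos_sub, Real.cos_add]; ring
  have key2 : ∀ A B : ℝ, 2 * (Real.cos A * Real.cos B) = Real.cos (A - B) + Real.cos (A + B) := by
    intro A B; rw [Real.cos_sub, Real.cos_add]; ring
  have h1 := key p (q + r - p)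
  have h2 := key q r
  have e1 : p - (q + r - p) = 2 * p - q - r := by ring
  have e2 : p + (q + r - p) = q + r := by ring
  rw [e1, e2] at h1
  have h3 := key2 (2 * p - q - r) (q - r)
  have h4 := key2 (2 * p - q - r) (q + r)
  have h5 := key2 (q + r) (q - r)
  have h6 := key2 (q + r) (q + r)
  have c1 : Real.cos (2 * (q - p)) = Real.cos (2 * p - q - r - (q - r)) := by
    rw [← Real.cos_neg]; congr 1; ring
  have c2 : Real.cos (2 * (p - r)) = Real.cos (2 * p - q - r + (q - r)) := by
    congr 1; ring
  have c3 : Real.cos (2 * p) = Real.cos (2 * p - q - r + (q + r)) := by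
    congr 1; ring
  have c4 : Real.cos (2 * (q + r - p)) = Real.cos (2 * p - q - r - (q + r)) := by
    rw [← Real.cos_neg]; congr 1; ring
  have c5 : Real.cos (2 * q) = Real.cos (q + r + (q - r)) := by congr 1; ring
  have c6 : Real.cos (2 * r) = Real.cos (q + r - (q - r)) := by congr 1; ring
  have c7 : Real.cos (2 * (q + r)) = Real.cos (q + r + (q + r)) := by congr 1; ring
  have c8 : (1 : ℝ) = Real.cos (q + r - (q + r)) := by simp
  have : 8 * (Real.sin p * Real.sin q * Real.sin r * Real.sin (q + r - p))
      = 2 * ((2 * (Real.sin p * Real.sin (q + r - p))) * (2 * (Real.sin q * Real.sin r))) := by ring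
  rw [this, h1, h2]
  rw [c1, c2, c3, c4, c5, c6, c7]
  nth_rewrite 1 [c8]
  linear_combination -h3 + h4 + h5 - h6

lemma crossForm_coe (x y u v : ℝ) : crossForm x y u v =
    8 * (Real.sin (Real.pi * (x - u)) * Real.sin (Real.pi * (x - v)) *
      Real.sin (Real.pi * (y - u)) * Real.sin (Real.pi * (y - v))) := by
  have h := trig_identity (Real.pi * (x - u)) (Real.pi * (x - v)) (Real.pi * (y - u))
  unfold crossForm
  simp only [← AddCircle.coe_sub, ← AddCircle.coe_add, toC_coe_re]
  convert h using 2
  all_goals congr 1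
  all_goals ring_nf

lemma crossForm_swap_left (x y u v : S1) : crossForm y x u v = crossForm x y u v := by
  obtain ⟨x, -, -, rfl⟩ := exists_lift 0 0 x
  obtain ⟨y, -, -, rfl⟩ := exists_lift 0 0 y
  obtain ⟨u, -, -, rfl⟩ := exists_lift 0 0 u
  obtain ⟨v, -, -, rfl⟩ := exists_lift 0 0 v
  rw [crossForm_coe, crossForm_coe]; ring

lemma crossForm_swap_right (x y u v : S1) : crossForm x y v u = crossForm x y u v := by
  obtain ⟨x, -, -, rfl⟩ := exists_lift 0 0 x
  obtain ⟨y, -, -, rfl⟩ := exists_lift 0 0 y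
  obtain ⟨u, -, -, rfl⟩ := exists_lift 0 0 u
  obtain ⟨v, -, -, rfl⟩ := exists_lift 0 0 v
  rw [crossForm_coe, crossForm_coe]; ring

lemma crossForm_comm (x y u v : S1) : crossForm u v x y = crossForm x y u v := by
  obtain ⟨x, -, -, rfl⟩ := exists_lift 0 0 x
  obtain ⟨y, -, -, rfl⟩ := exists_lift 0 0 y
  obtain ⟨u, -, -, rfl⟩ := exists_lift 0 0 u
  obtain ⟨v, -, -, rfl⟩ := exists_lift 0 0 v
  rw [crossForm_coe, crossForm_coe, ← neg_sub (0 + x) (0 + u), ← neg_sub (0 + x) (0 + v),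
    ← neg_sub (0 + y) (0 + u), ← neg_sub (0 + y) (0 + v)]
  simp only [mul_neg, Real.sin_neg]
  ring

lemma crossForm_antip (x y u v : S1) :
    crossForm (antip x) (antip y) (antip u) (antip v) = crossForm x y u v := by
  obtain ⟨x, -, -, rfl⟩ := exists_lift 0 0 x
  obtain ⟨y, -, -, rfl⟩ := exists_lift 0 0 y
  obtain ⟨u, -, -, rfl⟩ := exists_lift 0 0 u
  obtain ⟨v, -, -, rfl⟩ := exists_lift 0 0 v
  simp only [antip_coe]
  rw [crossForm_coe, crossForm_coe]
  simp only [add_sub_add_right_eq_sub]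

lemma sin_pi_pos {d : ℝ} (h0 : 0 < d) (h1 : d < 1) : 0 < Real.sin (Real.pi * d) :=
  Real.sin_pos_of_pos_of_lt_pi (by positivity) (by nlinarith [Real.pi_pos])

lemma sin_pi_nonneg {d : ℝ} (h0 : 0 ≤ d) (h1 : d ≤ 1) : 0 ≤ Real.sin (Real.pi * d) :=
  Real.sin_nonneg_of_nonneg_of_le_pi (by positivity) (by nlinarith [Real.pi_pos])

lemma sin_pi_sub_comm (x y : ℝ) : Real.sin (Real.pi * (x - y)) = - Real.sin (Real.pi * (y - x)) := by
  rw [← Real.sin_neg]; congr 1; ring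

lemma crossForm_pos_of_lt {x y u v : ℝ} (h1 : x < u) (h2 : x < v) (h3 : y < u) (h4 : y < v)
    (h5 : u < x + 1) (h6 : v < x + 1) (h7 : u < y + 1) (h8 : v < y + 1) :
    0 < crossForm x y u v := by
  rw [crossForm_coe, sin_pi_sub_comm x, sin_pi_sub_comm x, sin_pi_sub_comm y, sin_pi_sub_comm y]
  have := sin_pi_pos (d := u - x) (by linarith) (by linarith)
  have := sin_pi_pos (d := v - x) (by linarith) (by linarith)
  have := sin_pi_pos (d := u - y) (by linarith) (by linarith)
  have := sin_pi_pos (d := v - y) (by linarith) (by linarith)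
  simp only [mul_neg, neg_mul, neg_neg]
  positivity

lemma crossForm_nonneg_of_le {x y u v : ℝ} (h1 : x ≤ u) (h2 : x ≤ v) (h3 : y ≤ u) (h4 : y ≤ v)
    (h5 : u ≤ x + 1) (h6 : v ≤ x + 1) (h7 : u ≤ y + 1) (h8 : v ≤ y + 1) :
    0 ≤ crossForm x y u v := by
  rw [crossForm_coe, sin_pi_sub_comm x, sin_pi_sub_comm x, sin_pi_sub_comm y, sin_pi_sub_comm y]
  have := sin_pi_nonneg (d := u - x) (by linarith) (by linarith)
  have := sin_pi_nonneg (d := v - x) (by linarith) (by linarith)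
  have := sin_pi_nonneg (d := u - y) (by linarith) (by linarith)
  have := sin_pi_nonneg (d := v - y) (by linarith) (by linarith)
  simp only [mul_neg, neg_mul, neg_neg]
  positivity

lemma crossForm_neg_of_alternate {a b c d : ℝ} (h1 : a < b) (h2 : b < c) (h3 : c < d)
    (h4 : d < a + 1) : crossForm a c b d < 0 := by
  rw [crossForm_coe, sin_pi_sub_comm a b, sin_pi_sub_comm a d, sin_pi_sub_comm c d]
  have := sin_pi_pos (d := b - a) (by linarith) (by linarith)
  have := sin_pi_pos (d := d - a) (by linarith) (by linarith)
  have := sin_pi_pos (d := c - b) (by linarith) (by linarith)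
  have := sin_pi_pos (d := d - c) (by linarith) (by linarith)
  simp only [mul_neg, neg_mul, neg_neg, Left.neg_neg_iff]
  positivity

lemma crosses_iff (x y u v : S1) : Crosses s(x, y) s(u, v) ↔ crossForm x y u v < 0 := by
  constructor
  · rintro (⟨a, b, c, d, h1, h2, h3, h4, e1, e2⟩ | ⟨a, b, c, d, h1, h2, h3, h4, e2, e1⟩)
    all_goals
      have h := crossForm_neg_of_alternate h1 h2 h3 h4
      rcases Sym2.eq_iff.1 e1 with ⟨rfl, rfl⟩ | ⟨rfl, rfl⟩ <;>
      rcases Sym2.eq_iff.1 e2 with ⟨rfl, rfl⟩ | ⟨rfl, rfl⟩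
    · exact h
    · rwa [crossForm_swap_right]
    · rwa [crossForm_swap_left]
    · rwa [crossForm_swap_right, crossForm_swap_left]
    · rwa [crossForm_comm]
    · rwa [crossForm_comm, crossForm_swap_left]
    · rwa [crossForm_comm, crossForm_swap_right]
    · rwa [crossForm_comm, crossForm_swap_right, crossForm_swap_left]
  · intro h
    obtain ⟨a, -, -, rfl⟩ := exists_lift 0 0 x
    rw [zero_add] at *
    obtain ⟨c, hc0, hc1, rfl⟩ := exists_lift a 0 y
    obtain ⟨b, hb0, hb1, rfl⟩ := exists_lift a 0 u
    obtain ⟨d, hd0, hd1, rfl⟩ := exists_lift a 0 v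
    rw [crossForm_coe, sin_pi_sub_comm a, sin_pi_sub_comm a] at h
    have e1 : a + b - a = b := by ring
    have e2 : a + d - a = d := by ring
    have e3 : a + c - (a + b) = c - b := by ring
    have e4 : a + c - (a + d) = c - d := by ring
    rw [e1, e2, e3, e4] at h
    have hb := sin_pi_nonneg hb0 (by linarith)
    have hd := sin_pi_nonneg hd0 (by linarith)
    have hbpos : 0 < b := lt_of_le_of_ne hb0 (by rintro rfl; simp at h)
    have hdpos : 0 < d := lt_of_le_of_ne hd0 (by rintro rfl; simp at h)
    have hmul : Real.sin (Real.pi * (c - b)) * Real.sin (Real.pi * (c - d)) < 0 := by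
      by_contra hcon
      push Not at hcon
      have := mul_nonneg (mul_nonneg hb hd) hcon
      nlinarith
    rcases le_total c b with hcb | hcb
    · have hs := sin_pi_nonneg (d := b - c) (by linarith) (by linarith)
      rw [sin_pi_sub_comm] at hmul
      have hdc : d < c := by
        by_contra hcon
        push Not at hcon
        have := sin_pi_nonneg (d := d - c) (by linarith) (by linarith)
        rw [sin_pi_sub_comm c d] at hmul
        nlinarith
      have hcb' : c ≠ b := by rintro rfl; simp at hmul
      refine Or.inl ⟨a, a + d, a + c, a + b, by linarith, by linarith, ?_, by linarith, rfl,
        Sym2.eq_swap⟩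
      have := lt_of_le_of_ne hcb hcb'
      linarith
    · have hs := sin_pi_nonneg (d := c - b) (by linarith) (by linarith)
      have hdc : c < d := by
        by_contra hcon
        push Not at hcon
        have := sin_pi_nonneg (d := c - d) (by linarith) (by linarith)
        nlinarith
      have hcb' : b ≠ c := by rintro rfl; simp at hmul
      refine Or.inl ⟨a, a + b, a + c, a + d, by linarith, ?_, by linarith, by linarith, rfl, rfl⟩
      have := lt_of_le_of_ne hcb hcb'
      linarith

lemma not_crosses_iff (x y u v : S1) : ¬ Crosses s(x, y) s(u, v) ↔ 0 ≤ crossForm x y u v := by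
  rw [crosses_iff, not_lt]

lemma crossForm_diag (x u v : S1) : 0 ≤ crossForm x x u v := by
  obtain ⟨x, -, -, rfl⟩ := exists_lift 0 0 x
  obtain ⟨u, -, -, rfl⟩ := exists_lift 0 0 u
  obtain ⟨v, -, -, rfl⟩ := exists_lift 0 0 v
  rw [crossForm_coe]
  nlinarith [mul_self_nonneg (Real.sin (Real.pi * (0 + x - (0 + u))) *
    Real.sin (Real.pi * (0 + x - (0 + v))))]

lemma not_crosses_of_isDiag {ℓ ℓ' : Chord} (h : ℓ.IsDiag) : ¬ Crosses ℓ ℓ' ∧ ¬ Crosses ℓ' ℓ := by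
  induction ℓ using Sym2.ind with
  | _ x y =>
    induction ℓ' using Sym2.ind with
    | _ u v =>
      obtain rfl : x = y := h
      rw [not_crosses_iff, not_crosses_iff, crossForm_comm x x u v]
      exact ⟨crossForm_diag x u v, crossForm_diag x u v⟩

lemma crossForm_s3 (x y u v : S1) : crossForm (s3 x) (s3 y) (s3 u) (s3 v) = crossForm x y u v *
    ((1 + 2 * (toC (x - u)).re) * (1 + 2 * (toC (x - v)).re) *
      (1 + 2 * (toC (y - u)).re) * (1 + 2 * (toC (y - v)).re)) := by
  obtain ⟨x, -, -, rfl⟩ := exists_lift 0 0 x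
  obtain ⟨y, -, -, rfl⟩ := exists_lift 0 0 y
  obtain ⟨u, -, -, rfl⟩ := exists_lift 0 0 u
  obtain ⟨v, -, -, rfl⟩ := exists_lift 0 0 v
  have key : ∀ a b : ℝ, Real.sin (Real.pi * (3 * a - 3 * b)) = Real.sin (Real.pi * (a - b)) *
      (1 + 2 * (toC ((a : S1) - (b : S1))).re) := by
    intro a b
    rw [← AddCircle.coe_sub, toC_coe_re,
      show Real.pi * (3 * a - 3 * b) = 3 * (Real.pi * (a - b)) by ring,
      show 2 * Real.pi * (a - b) = 2 * (Real.pi * (a - b)) by ring, Real.sin_three_mul,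
      Real.cos_two_mul, Real.cos_sq']
    ring
  simp only [s3_coe]
  rw [crossForm_coe, crossForm_coe, key, key, key, key]
  ring

lemma continuous_crossForm :
    Continuous fun z : (S1 × S1) × (S1 × S1) => crossForm z.1.1 z.1.2 z.2.1 z.2.2 := by
  have key : ∀ f : (S1 × S1) × (S1 × S1) → S1, Continuous f → Continuous fun z => (toC (f z)).re :=
    fun f hf => Complex.continuous_re.comp (continuous_toC.comp hf)
  have h1 : Continuous fun z : (S1 × S1) × (S1 × S1) => z.1.1 := continuous_fst.comp continuous_fst
  have h2 : Continuous fun z : (S1 × S1) × (S1 × S1) => z.1.2 := continuous_snd.comp continuous_fst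
  have h3 : Continuous fun z : (S1 × S1) × (S1 × S1) => z.2.1 := continuous_fst.comp continuous_snd
  have h4 : Continuous fun z : (S1 × S1) × (S1 × S1) => z.2.2 := continuous_snd.comp continuous_snd
  exact (((((((key _ (h1.sub h2)).add (key _ (h3.sub h4))).sub (key _ (h1.sub h3))).sub
    (key _ (h2.sub h4))).sub (key _ (h1.sub h4))).sub (key _ (h2.sub h3))).add
    continuous_const).add (key _ (((h1.add h2).sub h3).sub h4))

/-! ### Heights -/

/-- The height of `z` in the direction of angle `m`. -/
def height (m : ℝ) (z : ℂ) : ℝ := z.re * Real.cos (2 * Real.pi * m) + z.im * Real.sin (2 * Real.pi * m)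

lemma height_toC (m x : ℝ) : height m (toC (x : S1)) = Real.cos (2 * Real.pi * (x - m)) := by
  rw [height, toC_coe_re, toC_coe_im, mul_sub, Real.cos_sub]

lemma continuous_height (m : ℝ) : Continuous (height m) := by
  unfold height; fun_prop

lemma height_combo (m : ℝ) (p q : ℝ) (z w : ℂ) :
    height m (p • z + q • w) = p * height m z + q * height m w := by
  simp [height]; ring

lemma height_neg (m : ℝ) (z : ℂ) : height m (-z) = -height m z := by
  simp [height]; ring

lemma convex_height_Icc (m p q : ℝ) : Convex ℝ {z | height m z ∈ Icc p q} := by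
  intro z hz w hw a b ha hb hab
  change height m _ ∈ Icc p q
  rw [height_combo]
  exact convex_Icc p q hz hw ha hb hab

lemma height_mem_of_mem_segment {m p q : ℝ} {z w v : ℂ} (hz : height m z ∈ Icc p q)
    (hw : height m w ∈ Icc p q) (hv : v ∈ segment ℝ z w) : height m v ∈ Icc p q :=
  (convex_height_Icc m p q).segment_subset hz hw hv

lemma height_sub_eq (x y u : ℝ) : height ((x + y) / 2) (toC (u : S1)) - Real.cos (Real.pi * (y - x)) =
    -2 * (Real.sin (Real.pi * (x - u)) * Real.sin (Real.pi * (y - u))) := by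
  rw [height_toC, Real.cos_sub_cos]
  rw [show (2 * Real.pi * (u - (x + y) / 2) + Real.pi * (y - x)) / 2 = -(Real.pi * (x - u)) by ring,
    show (2 * Real.pi * (u - (x + y) / 2) - Real.pi * (y - x)) / 2 = -(Real.pi * (y - u)) by ring,
    Real.sin_neg, Real.sin_neg]
  ring

/-- Chords on which the crossing form is positive are disjoint. -/
lemma disjoint_of_crossForm_pos {x y u v : S1} (h : 0 < crossForm x y u v) :
    Disjoint (chordSet s(x, y)) (chordSet s(u, v)) := by
  obtain ⟨x, -, -, rfl⟩ := exists_lift 0 0 x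
  obtain ⟨y, -, -, rfl⟩ := exists_lift 0 0 y
  obtain ⟨u, -, -, rfl⟩ := exists_lift 0 0 u
  obtain ⟨v, -, -, rfl⟩ := exists_lift 0 0 v
  simp only [zero_add] at *
  rw [crossForm_coe] at h
  have hx := height_sub_eq x y x
  have hy := height_sub_eq x y y
  have hu := height_sub_eq x y u
  have hv := height_sub_eq x y v
  simp only [sub_self, mul_zero, Real.sin_zero, zero_mul] at hx hy
  rw [Set.disjoint_left]
  rintro z ⟨a, b, ha, hb, hab, rfl⟩ ⟨c, d, hc, hd, hcd, h2⟩
  have h3 := congrArg (height ((x + y) / 2)) h2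
  rw [height_combo, height_combo] at h3
  set A := Real.sin (Real.pi * (x - u)) * Real.sin (Real.pi * (y - u))
  set B := Real.sin (Real.pi * (x - v)) * Real.sin (Real.pi * (y - v))
  have hAB : 0 < A * B := by
    have : A * B = Real.sin (Real.pi * (x - u)) * Real.sin (Real.pi * (x - v)) *
      Real.sin (Real.pi * (y - u)) * Real.sin (Real.pi * (y - v)) := by ring
    linarith
  have h4 : c * A + d * B = 0 := by
    have e : height ((x + y) / 2) (toC (x : S1)) = Real.cos (Real.pi * (y - x)) := by linarith
    have e' : height ((x + y) / 2) (toC (y : S1)) = Real.cos (Real.pi * (y - x)) := by linarith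
    have e'' : height ((x + y) / 2) (toC (u : S1)) = Real.cos (Real.pi * (y - x)) - 2 * A := by linarith
    have e''' : height ((x + y) / 2) (toC (v : S1)) = Real.cos (Real.pi * (y - x)) - 2 * B := by linarith
    rw [e, e', e'', e'''] at h3
    have h5 : (a + b) * Real.cos (Real.pi * (y - x)) = Real.cos (Real.pi * (y - x)) := by
      rw [hab, one_mul]
    have h6 : (c + d) * Real.cos (Real.pi * (y - x)) = Real.cos (Real.pi * (y - x)) := by
      rw [hcd, one_mul]
    linarith
  rcases pos_and_pos_or_neg_and_neg_of_mul_pos hAB with ⟨hA, hB⟩ | ⟨hA, hB⟩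
  · rcases hc.lt_or_eq with hc | rfl
    · nlinarith [mul_pos hc hA, mul_nonneg hd hB.le]
    · nlinarith
  · rcases hc.lt_or_eq with hc | rfl
    · nlinarith [mul_pos hc (neg_pos.2 hA), mul_nonneg hd (neg_pos.2 hB).le]
    · nlinarith

lemma not_disjoint_of_common (x y v : S1) : ¬ Disjoint (chordSet s(x, y)) (chordSet s(x, v)) :=
  fun h => Set.disjoint_left.1 h (left_mem_segment ℝ _ _) (left_mem_segment ℝ _ _)

lemma IsMajor.antip {L : Set Chord} (hL : ∀ ℓ ∈ L, cmap antip ℓ ∈ L) {M : Chord}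
    (hM : IsMajor L M) : IsMajor L (cmap antip M) :=
  ⟨hL _ hM.1, fun ℓ hℓ => by rw [chordLen_antip]; exact hM.2 ℓ hℓ⟩

lemma IsComajor.antip {L : Set Chord} (hL : ∀ ℓ ∈ L, cmap antip ℓ ∈ L) {c : Chord}
    (hc : IsComajor L c) : IsComajor L (cmap antip c) := by
  obtain ⟨h1, h2, ⟨M, hM, h3⟩, h4⟩ := hc
  refine ⟨by rwa [chordLen_antip, isDiag_antip], fun h => hL _ (h2 (by rwa [isDiag_antip] at h)),
    ⟨_, hM.antip hL, by rw [cmap_s3_antip, cmap_s3_antip, h3]⟩, fun N hN => ?_⟩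
  have h5 := h4 _ (hN.antip hL)
  rw [chordSet_antip] at h5 ⊢
  rw [Set.disjoint_left] at h5 ⊢
  intro z hz hz'
  exact h5 (Set.mem_neg.1 hz) (by simpa using hz')

/-! ### Arcs -/

/-- The closed arc of angles `m + θ` with `p ≤ θ ≤ q`. -/
def arc (m p q : ℝ) : Set S1 := (fun θ : ℝ => ((m + θ : ℝ) : S1)) '' Icc p q

lemma isCompact_arc (m p q : ℝ) : IsCompact (arc m p q) := by
  apply isCompact_Icc.image
  exact (AddCircle.continuous_mk' 1).comp (continuous_const.add continuous_id)

lemma mem_arc {m p q θ : ℝ} (h1 : p ≤ θ) (h2 : θ ≤ q) : ((m + θ : ℝ) : S1) ∈ arc m p q :=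
  ⟨θ, ⟨h1, h2⟩, rfl⟩

lemma mem_arc_of_eq {m p q θ x : ℝ} (n : ℤ) (hx : x = m + θ + n) (h1 : p ≤ θ) (h2 : θ ≤ q) :
    (x : S1) ∈ arc m p q := by
  rw [coe_eq_coe n hx]
  exact mem_arc h1 h2

/-! ### Degenerate comajors -/

lemma exists_lamination_of_isDiag (x : S1) : ∃ L : Set Chord, IsCubicSymLam L ∧ IsComajor L s(x, x) := by
  obtain ⟨a, -, -, rfl⟩ := exists_lift 0 0 x
  rw [zero_add]
  set K : Set S1 := arc a (1 / 12) (5 / 12) ∪ arc a (7 / 12) (11 / 12) with hK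
  have hKc : IsCompact K := (isCompact_arc _ _ _).union (isCompact_arc _ _ _)
  have hsymm : ∀ y ∈ K, antip y ∈ K := by
    rintro y (⟨θ, ⟨h1, h2⟩, rfl⟩ | ⟨θ, ⟨h1, h2⟩, rfl⟩)
    · right
      rw [antip_coe]
      exact mem_arc_of_eq (θ := θ + 1 / 2) 0 (by push_cast; ring) (by linarith) (by linarith)
    · left
      rw [antip_coe]
      exact mem_arc_of_eq (θ := θ - 1 / 2) 1 (by push_cast; ring) (by linarith) (by linarith)
  have hback : ∀ y : S1, ∃ z ∈ K, s3 z = y := by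
    intro y
    obtain ⟨θ, h1, h2, rfl⟩ := exists_lift (3 * a) (1 / 4) y
    refine ⟨((a + θ / 3 : ℝ) : S1), Or.inl (mem_arc (by linarith) (by linarith)), ?_⟩
    rw [s3_coe]; congr 1; ring
  have hdisj : ∀ y ∈ K, Disjoint (chordSet s((a : S1), (a : S1))) (chordSet s(y, y)) := by
    rintro y (⟨θ, ⟨h1, h2⟩, rfl⟩ | ⟨θ, ⟨h1, h2⟩, rfl⟩) <;>
    exact disjoint_of_crossForm_pos (crossForm_pos_of_lt (by linarith) (by linarith) (by linarith)
      (by linarith) (by linarith) (by linarith) (by linarith) (by linarith))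
  have hmajor : ∀ y ∈ K, IsMajor ((fun y => s(y, y)) '' K) s(y, y) := by
    intro y hy
    refine ⟨mem_image_of_mem _ hy, ?_⟩
    rintro _ ⟨z, -, rfl⟩
    simp [chordLen_mk]
  refine ⟨(fun y => s(y, y)) '' K, ⟨⟨⟨?_, ?_⟩, ?_, ?_, ?_⟩, ?_⟩, ?_⟩
  · rintro _ ⟨y, -, rfl⟩ ℓ -
    exact (not_crosses_of_isDiag (Sym2.diag_isDiag y)).1
  · have : unionSet ((fun y => s(y, y)) '' K) = toC '' K := by
      ext z
      simp [unionSet, chordSet_mk, eq_comm]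
    rw [this]
    exact (hKc.image continuous_toC).isClosed
  · rintro _ ⟨y, -, rfl⟩
    exact Or.inr rfl
  · rintro _ ⟨y, -, rfl⟩
    obtain ⟨z, hz, rfl⟩ := hback y
    exact ⟨_, mem_image_of_mem _ hz, rfl⟩
  · rintro _ ⟨y, -, rfl⟩ h
    exact absurd rfl h
  · rintro _ ⟨y, hy, rfl⟩
    exact mem_image_of_mem _ (hsymm y hy)
  · have h3 : ((a + 1 / 3 : ℝ) : S1) ∈ K := Or.inl (mem_arc (by norm_num) (by norm_num))
    refine ⟨Or.inr rfl, fun h => absurd rfl h, ⟨_, hmajor _ h3, ?_⟩, ?_⟩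
    · rw [cmap_mk, cmap_mk, s3_coe, s3_coe,
        coe_eq_coe (x := 3 * (a + 1 / 3)) (y := 3 * a) 1 (by push_cast; ring)]
    · rintro M ⟨⟨y, hy, rfl⟩, -⟩
      exact hdisj y hy

/-! ### Heights and the strips -/

lemma cos_le_cos_of_le {d e : ℝ} (hd : 0 ≤ d) (hde : d ≤ e) (he : e ≤ 1 / 2) :
    Real.cos (2 * Real.pi * e) ≤ Real.cos (2 * Real.pi * d) :=
  Real.strictAntiOn_cos.antitoneOn ⟨by positivity, by nlinarith [Real.pi_pos]⟩
    ⟨by nlinarith [Real.pi_pos], by nlinarith [Real.pi_pos]⟩ (by nlinarith [Real.pi_pos])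

lemma cos_lt_cos_of_lt {d e : ℝ} (hd : 0 ≤ d) (hde : d < e) (he : e ≤ 1 / 2) :
    Real.cos (2 * Real.pi * e) < Real.cos (2 * Real.pi * d) :=
  Real.strictAntiOn_cos ⟨by positivity, by nlinarith [Real.pi_pos]⟩
    ⟨by nlinarith [Real.pi_pos], by nlinarith [Real.pi_pos]⟩ (by nlinarith [Real.pi_pos])

lemma le_of_cos_le {d e : ℝ}
    (h : Real.cos (2 * Real.pi * e) ≤ Real.cos (2 * Real.pi * d)) : d ≤ e ∨ 1 / 2 < d ∨ e < 0 := by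
  by_contra hcon
  push Not at hcon
  exact absurd (cos_lt_cos_of_lt hcon.2.2 hcon.1 hcon.2.1) (not_lt.2 h)

lemma cos_two_pi_abs (d : ℝ) : Real.cos (2 * Real.pi * |d|) = Real.cos (2 * Real.pi * d) := by
  rw [← Real.cos_abs (2 * Real.pi * d), abs_mul, abs_of_pos (by positivity : 0 < 2 * Real.pi)]

lemma height_coe_add (m θ : ℝ) :
    height m (toC ((m + θ : ℝ) : S1)) = Real.cos (2 * Real.pi * |θ|) := by
  rw [height_toC, cos_two_pi_abs, add_sub_cancel_left]

lemma crossForm_horizontal (m d : ℝ) (x y : S1) :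
    crossForm ((m + d : ℝ) : S1) ((m - d : ℝ) : S1) x y =
      2 * ((Real.cos (2 * Real.pi * d) - height m (toC x)) *
        (Real.cos (2 * Real.pi * d) - height m (toC y))) := by
  obtain ⟨x, -, -, rfl⟩ := exists_lift m 0 x
  obtain ⟨y, -, -, rfl⟩ := exists_lift m 0 y
  rw [crossForm_coe, height_coe_add, height_coe_add, cos_two_pi_abs, cos_two_pi_abs]
  have key : ∀ x : ℝ, Real.cos (2 * Real.pi * d) - Real.cos (2 * Real.pi * x) =
      2 * (Real.sin (Real.pi * (m + d - (m + x))) * Real.sin (Real.pi * (m - d - (m + x)))) := by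
    intro x
    rw [Real.cos_sub_cos,
      show (2 * Real.pi * d + 2 * Real.pi * x) / 2 = -(Real.pi * (m - d - (m + x))) by ring,
      show (2 * Real.pi * d - 2 * Real.pi * x) / 2 = Real.pi * (m + d - (m + x)) by ring,
      Real.sin_neg]
    ring
  rw [key, key]
  ring

/-- The lower height of the strip over a chord of length `t`. -/
def lowHeight (t : ℝ) : ℝ := Real.cos (2 * Real.pi * (1 / 3 + t / 2))

/-- The upper height of the strip over a chord of length `t`. -/
def highHeight (t : ℝ) : ℝ := Real.cos (2 * Real.pi * (1 / 3 - t / 2))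

lemma lowHeight_lt_highHeight {t : ℝ} (h0 : 0 < t) (h1 : t < 1 / 6) :
    lowHeight t < highHeight t :=
  cos_lt_cos_of_lt (by linarith) (by linarith) (by linarith)

lemma highHeight_neg {t : ℝ} (h0 : 0 < t) (h1 : t < 1 / 6) : highHeight t < 0 := by
  have := cos_lt_cos_of_lt (d := 1 / 4) (e := 1 / 3 - t / 2) (by norm_num) (by linarith)
    (by linarith)
  rwa [show 2 * Real.pi * (1 / 4) = Real.pi / 2 by ring, Real.cos_pi_div_two] at this

lemma neg_lowHeight (t : ℝ) : -lowHeight t = Real.cos (2 * Real.pi * (1 / 6 - t / 2)) := by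
  rw [lowHeight, ← Real.cos_pi_sub]; congr 1; ring

lemma neg_highHeight (t : ℝ) : -highHeight t = Real.cos (2 * Real.pi * (1 / 6 + t / 2)) := by
  rw [highHeight, ← Real.cos_pi_sub]; congr 1; ring

lemma height_add_half (m : ℝ) (z : ℂ) : height (m + 1 / 2) z = -height m z := by
  unfold height
  rw [show 2 * Real.pi * (m + 1 / 2) = 2 * Real.pi * m + Real.pi by ring, Real.cos_add_pi,
    Real.sin_add_pi]
  ring

lemma height_mem_of_mem_QStrip {a t : ℝ} (h0 : 0 < t) (h1 : t < 1 / 6) {z : ℂ}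
    (hz : z ∈ QStrip a t) : height (a + t / 2) z ∈ Icc (lowHeight t) (highHeight t) := by
  refine convexHull_min ?_ (convex_height_Icc _ _ _) hz
  rintro _ (⟨θ, ⟨h2, h3⟩, rfl⟩ | ⟨θ, ⟨h2, h3⟩, rfl⟩)
  · change height (a + t / 2) (toC (θ : S1)) ∈ Icc (lowHeight t) (highHeight t)
    rw [height_toC]
    exact ⟨cos_le_cos_of_le (by linarith) (by linarith) (by linarith),
      cos_le_cos_of_le (by linarith) (by linarith) (by linarith)⟩
  · change height (a + t / 2) (toC (θ : S1)) ∈ Icc (lowHeight t) (highHeight t)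
    rw [← coe_add_int θ (-1), height_toC, ← Real.cos_neg, ← mul_neg]
    push_cast
    exact ⟨cos_le_cos_of_le (by linarith) (by linarith) (by linarith),
      cos_le_cos_of_le (by linarith) (by linarith) (by linarith)⟩

lemma height_mem_of_mem_interior {a t : ℝ} (h0 : 0 < t) (h1 : t < 1 / 6) {z : ℂ}
    (hz : z ∈ interior (QStrip a t ∪ QStrip (a + 1 / 2) t)) :
    height (a + t / 2) z ∈ Ioo (lowHeight t) (highHeight t) ∪
      Ioo (-highHeight t) (-lowHeight t) := by
  have hlh := lowHeight_lt_highHeight h0 h1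
  have hh := highHeight_neg h0 h1
  set m := a + t / 2
  have hsub : ∀ w ∈ interior (QStrip a t ∪ QStrip (a + 1 / 2) t), height m w ∈
      Icc (lowHeight t) (highHeight t) ∪ Icc (-highHeight t) (-lowHeight t) := by
    intro w hw
    rcases interior_subset hw with h | h
    · exact Or.inl (height_mem_of_mem_QStrip h0 h1 h)
    · have := height_mem_of_mem_QStrip h0 h1 h
      rw [show a + 1 / 2 + t / 2 = m + 1 / 2 by ring, height_add_half] at this
      exact Or.inr ⟨by linarith [this.2], by linarith [this.1]⟩
  obtain ⟨ε, hε, hball⟩ := Metric.isOpen_iff.1 isOpen_interior z hz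
  have hshift : ∀ s : ℝ, |s| < ε → height m z + s ∈
      Icc (lowHeight t) (highHeight t) ∪ Icc (-highHeight t) (-lowHeight t) := by
    intro s hs
    have hn : ‖toC (m : S1)‖ = 1 := by
      rw [toC_coe, show (2 * Real.pi * Complex.I * (m : ℂ)) =
        ((2 * Real.pi * m : ℝ) : ℂ) * Complex.I by push_cast; ring,
        Complex.norm_exp_ofReal_mul_I]
    have := hsub ((1 : ℝ) • z + s • toC (m : S1)) (hball (by simp [hn, hs]))
    rwa [height_combo, height_toC, sub_self, mul_zero, Real.cos_zero, one_mul, mul_one] at this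
  set δ := min (ε / 2) (-highHeight t / 2)
  have hδ : 0 < δ := lt_min (by linarith) (by linarith)
  have hδ1 : δ ≤ ε / 2 := min_le_left _ _
  have hδ2 : δ ≤ -highHeight t / 2 := min_le_right _ _
  have hp := hshift δ (by rw [abs_of_pos hδ]; linarith)
  have hm := hshift (-δ) (by rw [abs_neg, abs_of_pos hδ]; linarith)
  rcases hp with ⟨hp1, hp2⟩ | ⟨hp1, hp2⟩ <;> rcases hm with ⟨hm1, hm2⟩ | ⟨hm1, hm2⟩
  · exact Or.inl ⟨by linarith, by linarith⟩
  · linarith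
  · linarith
  · exact Or.inr ⟨by linarith, by linarith⟩

/-! ### Comajors of symmetric laminations are legal -/

lemma exists_coordinates {c : Chord} (hd : ¬ c.IsDiag) (hl : chordLen c < 1 / 6) :
    ∃ a t : ℝ, 0 < t ∧ t < 1 / 6 ∧ t = chordLen c ∧ c = s((a : S1), ((a + t : ℝ) : S1)) := by
  induction c using Sym2.ind with
  | _ x y =>
    obtain ⟨x, -, -, rfl⟩ := exists_lift 0 0 x
    rw [zero_add] at *
    obtain ⟨θ, h1, h2, rfl⟩ := exists_lift x (-1 / 2) y
    have hlen : chordLen s((x : S1), ((x + θ : ℝ) : S1)) = |θ| := by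
      rw [chordLen_mk, ← AddCircle.coe_sub, sub_add_cancel_left, AddCircle.coe_neg, norm_neg,
        norm_coe_of_abs_le (abs_le.2 ⟨by linarith, by linarith⟩)]
    rw [hlen] at hl
    have hθ : θ ≠ 0 := by
      rintro rfl
      exact hd (by simp)
    rcases lt_or_gt_of_ne hθ with h | h
    · refine ⟨x + θ, |θ|, abs_pos.2 hθ, hl, hlen.symm, ?_⟩
      rw [abs_of_neg h, Sym2.eq_swap, add_neg_cancel_right]
    · refine ⟨x, |θ|, abs_pos.2 hθ, hl, hlen.symm, ?_⟩
      rw [abs_of_pos h]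

lemma s3_fiber {a : ℝ} {u : S1} (h : s3 u = s3 (a : S1)) :
    ∃ i : ℕ, i < 3 ∧ u = ((a + i / 3 : ℝ) : S1) := by
  obtain ⟨θ, h1, h2, rfl⟩ := exists_lift a 0 u
  rw [s3_coe, s3_coe] at h
  obtain ⟨n, hn⟩ := exists_int_of_coe_eq h
  have hn' : 3 * θ = n := by linarith
  have hn0 : 0 ≤ n := by
    have : (0 : ℝ) ≤ n := by linarith
    exact_mod_cast this
  have hn3 : n < 3 := by
    have : (n : ℝ) < 3 := by linarith
    exact_mod_cast this
  lift n to ℕ using hn0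
  refine ⟨n, by exact_mod_cast hn3, ?_⟩
  congr 2
  push_cast at hn'
  linarith

lemma chord_fiber {a b : ℝ} {ℓ : Chord}
    (h : cmap s3 ℓ = cmap s3 s((a : S1), (b : S1))) :
    ∃ i j : ℕ, i < 3 ∧ j < 3 ∧ ℓ = s(((a + i / 3 : ℝ) : S1), ((b + j / 3 : ℝ) : S1)) := by
  induction ℓ using Sym2.ind with
  | _ x y =>
    rw [cmap_mk, cmap_mk] at h
    rcases Sym2.eq_iff.1 h with ⟨h1, h2⟩ | ⟨h1, h2⟩
    · obtain ⟨i, hi, rfl⟩ := s3_fiber h1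
      obtain ⟨j, hj, rfl⟩ := s3_fiber h2
      exact ⟨i, j, hi, hj, rfl⟩
    · obtain ⟨j, hj, rfl⟩ := s3_fiber h1
      obtain ⟨i, hi, rfl⟩ := s3_fiber h2
      exact ⟨i, j, hi, hj, Sym2.eq_swap⟩

lemma chordLen_sibling_eq {a t : ℝ} (h0 : 0 < t) (h1 : t < 1 / 6) (i : ℕ) :
    chordLen s(((a + i / 3 : ℝ) : S1), ((a + t + i / 3 : ℝ) : S1)) = t := by
  rw [chordLen_mk, ← AddCircle.coe_sub, show a + (i : ℝ) / 3 - (a + t + i / 3) = -t by ring,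
    AddCircle.coe_neg, norm_neg, norm_coe_of_nonneg h0.le (by linarith)]

lemma chordLen_sibling_ne {a t : ℝ} (h0 : 0 < t) (h1 : t < 1 / 6) {i j : ℕ} (hi : i < 3) (hj : j < 3)
    (hij : i ≠ j) :
    |1 / 3 - chordLen s(((a + i / 3 : ℝ) : S1), ((a + t + j / 3 : ℝ) : S1))| = t := by
  rw [chordLen_mk, ← norm_neg, neg_sub, ← AddCircle.coe_sub,
    show a + t + (j : ℝ) / 3 - (a + i / 3) = t + j / 3 - i / 3 by ring]
  have key : ∀ d : ℝ, ‖((d : ℝ) : S1)‖ = 1 / 3 + t ∨ ‖((d : ℝ) : S1)‖ = 1 / 3 - t →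
      |1 / 3 - ‖((d : ℝ) : S1)‖| = t := by
    rintro d (h | h) <;> rw [h]
    · rw [show 1 / 3 - (1 / 3 + t) = -t by ring, abs_neg, abs_of_pos h0]
    · rw [show 1 / 3 - (1 / 3 - t) = t by ring, abs_of_pos h0]
  apply key
  interval_cases i <;> interval_cases j <;> first | exact absurd rfl hij | skip
  · left; rw [norm_coe_of_nonneg] <;> push_cast <;> linarith
  · right; rw [norm_coe_of_half_le] <;> push_cast <;> linarith
  · right; rw [norm_coe_of_abs_le, abs_of_nonpos] <;> push_cast <;> first | linarith | skip
    rw [abs_of_nonpos] <;> linarith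
  · left; rw [norm_coe_of_nonneg] <;> push_cast <;> linarith
  · left; rw [← norm_neg, ← AddCircle.coe_neg, norm_coe_of_half_le] <;> push_cast <;> linarith
  · right; rw [norm_coe_of_abs_le, abs_of_nonpos] <;> push_cast <;> first | linarith | skip
    rw [abs_of_nonpos] <;> linarith

lemma norm_s3_ge {t : ℝ} {d : S1} (h1 : t ≤ ‖d‖) (h2 : t ≤ |1 / 3 - ‖d‖|) : 3 * t ≤ ‖s3 d‖ := by
  have key : ∀ θ : ℝ, 0 ≤ θ → θ ≤ 1 / 2 → t ≤ θ → t ≤ |1 / 3 - θ| → 3 * t ≤ ‖((3 * θ : ℝ) : S1)‖ := by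
    intro θ h3 h4 h5 h6
    rcases le_total θ (1 / 6) with h | h
    · rw [norm_coe_of_nonneg (by linarith) (by linarith)]
      linarith
    · rw [coe_eq_coe (x := 3 * θ) (y := 3 * θ - 1) 1 (by push_cast; ring),
        norm_coe_of_abs_le (abs_le.2 ⟨by linarith, by linarith⟩),
        show 3 * θ - 1 = -(3 * (1 / 3 - θ)) by ring, abs_neg, abs_mul, abs_of_pos three_pos]
      linarith
  obtain ⟨θ, h3, h4, rfl⟩ := exists_lift 0 (-1 / 2) d
  rw [zero_add, norm_coe_of_abs_le (abs_le.2 ⟨by linarith, by linarith⟩)] at *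
  rw [s3_coe]
  have h5 := key |θ| (abs_nonneg _) (abs_le.2 ⟨by linarith, by linarith⟩) h1 h2
  rcases abs_choice θ with h | h
  · rwa [h] at h5
  · rwa [h, mul_neg, AddCircle.coe_neg, norm_neg] at h5

lemma chordLen_cmap_s3_ge {t : ℝ} {ℓ : Chord} (h1 : t ≤ chordLen ℓ) (h2 : t ≤ |1 / 3 - chordLen ℓ|) :
    3 * t ≤ chordLen (cmap s3 ℓ) := by
  induction ℓ using Sym2.ind with
  | _ x y =>
    rw [cmap_mk, chordLen_mk, show s3 x - s3 y = s3 (x - y) by simp [s3, smul_sub]]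
    exact norm_s3_ge h1 h2

/-- A chord with both endpoints in the height range of the strip, of length at least `3t`, and not
closer to length `1/3` than `t`, lies in the boundary of the strip. -/
lemma height_eq_of_mem_band {m t : ℝ} (h0 : 0 < t) (h1 : t < 1 / 6) {x y : S1}
    (hl : 3 * t ≤ chordLen s(x, y)) (hl' : t ≤ |1 / 3 - chordLen s(x, y)|)
    (hx : height m (toC x) ∈ Icc (lowHeight t) (highHeight t))
    (hy : height m (toC y) ∈ Icc (lowHeight t) (highHeight t)) :
    (height m (toC x) = lowHeight t ∧ height m (toC y) = lowHeight t) ∨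
    (height m (toC x) = highHeight t ∧ height m (toC y) = highHeight t) := by
  obtain ⟨θ, hθ1, hθ2, rfl⟩ := exists_lift m (-1 / 2) x
  obtain ⟨φ, hφ1, hφ2, rfl⟩ := exists_lift m (-1 / 2) y
  have hθ : |θ| ≤ 1 / 2 := abs_le.2 ⟨by linarith, by linarith⟩
  have hφ : |φ| ≤ 1 / 2 := abs_le.2 ⟨by linarith, by linarith⟩
  have hθ0 := abs_nonneg θ
  have hφ0 := abs_nonneg φ
  rw [height_coe_add] at hx hy ⊢
  rw [height_coe_add]
  have hx1 : |θ| ≤ 1 / 3 + t / 2 := by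
    rcases le_of_cos_le hx.1 with h | h | h <;> linarith
  have hy1 : |φ| ≤ 1 / 3 + t / 2 := by
    rcases le_of_cos_le hy.1 with h | h | h <;> linarith
  have hx2 : 1 / 3 - t / 2 ≤ |θ| := by
    rcases le_of_cos_le hx.2 with h | h | h <;> linarith
  have hy2 : 1 / 3 - t / 2 ≤ |φ| := by
    rcases le_of_cos_le hy.2 with h | h | h <;> linarith
  rw [chordLen_mk, ← AddCircle.coe_sub, add_sub_add_left_eq_sub] at hl hl'
  have opp : ∀ d : ℝ, |θ| + |φ| = d → ‖((d : ℝ) : S1)‖ = ‖((θ - φ : ℝ) : S1)‖ →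
      (Real.cos (2 * Real.pi * |θ|) = lowHeight t ∧ Real.cos (2 * Real.pi * |φ|) = lowHeight t) ∨
      (Real.cos (2 * Real.pi * |θ|) = highHeight t ∧
        Real.cos (2 * Real.pi * |φ|) = highHeight t) := by
    intro d hd hn
    rw [← hn, norm_coe_of_half_le (by linarith) (by linarith), le_abs] at hl'
    rcases hl' with h | h
    · left
      rw [show |θ| = 1 / 3 + t / 2 by linarith, show |φ| = 1 / 3 + t / 2 by linarith]
      exact ⟨rfl, rfl⟩
    · right
      rw [show |θ| = 1 / 3 - t / 2 by linarith, show |φ| = 1 / 3 - t / 2 by linarith]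
      exact ⟨rfl, rfl⟩
  have same : |θ - φ| ≤ t → False := by
    intro h
    rw [norm_coe_of_abs_le (by linarith)] at hl
    linarith
  rcases abs_cases θ with ⟨e1, e1'⟩ | ⟨e1, e1'⟩ <;> rcases abs_cases φ with ⟨e2, e2'⟩ | ⟨e2, e2'⟩
  · exact (same (abs_le.2 ⟨by linarith, by linarith⟩)).elim
  · exact opp (θ - φ) (by linarith) rfl
  · exact opp (φ - θ) (by linarith) (by rw [← norm_neg, ← AddCircle.coe_neg, neg_sub])
  · exact (same (abs_le.2 ⟨by linarith, by linarith⟩)).elim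

lemma mul_sub_nonneg_cases {w x y : ℝ} (h : 0 ≤ (w - x) * (w - y)) :
    (x ≤ w ∧ y ≤ w) ∨ (w ≤ x ∧ w ≤ y) := by
  rcases mul_nonneg_iff.1 h with ⟨h1, h2⟩ | ⟨h1, h2⟩
  · exact Or.inl ⟨by linarith, by linarith⟩
  · exact Or.inr ⟨by linarith, by linarith⟩

lemma height_antip (m : ℝ) (x : S1) : height m (toC (antip x)) = -height m (toC x) := by
  rw [toC_antip, height_neg]

lemma inter_interior_eq_empty_of_Icc {a t p q : ℝ} (h0 : 0 < t) (h1 : t < 1 / 6) {x y : S1}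
    (hx : height (a + t / 2) (toC x) ∈ Icc p q) (hy : height (a + t / 2) (toC y) ∈ Icc p q)
    (hpq : ∀ h ∈ Icc p q, h ∉ Ioo (lowHeight t) (highHeight t) ∪
      Ioo (-highHeight t) (-lowHeight t)) :
    chordSet s(x, y) ∩ interior (QStrip a t ∪ QStrip (a + 1 / 2) t) = ∅ := by
  rw [Set.eq_empty_iff_forall_notMem]
  rintro z ⟨hz1, hz2⟩
  exact hpq _ (height_mem_of_mem_segment hx hy hz1) (height_mem_of_mem_interior h0 h1 hz2)

lemma inter_interior_eq_empty {a t : ℝ} (h0 : 0 < t) (h1 : t < 1 / 6) {x y : S1}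
    (hl : 3 * t ≤ chordLen s(x, y)) (hl' : t ≤ |1 / 3 - chordLen s(x, y)|)
    (hlow : 0 ≤ (lowHeight t - height (a + t / 2) (toC x)) *
      (lowHeight t - height (a + t / 2) (toC y)))
    (hhigh : 0 ≤ (highHeight t - height (a + t / 2) (toC x)) *
      (highHeight t - height (a + t / 2) (toC y)))
    (hlow' : 0 ≤ (-lowHeight t - height (a + t / 2) (toC x)) *
      (-lowHeight t - height (a + t / 2) (toC y)))
    (hhigh' : 0 ≤ (-highHeight t - height (a + t / 2) (toC x)) *
      (-highHeight t - height (a + t / 2) (toC y))) :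
    chordSet s(x, y) ∩ interior (QStrip a t ∪ QStrip (a + 1 / 2) t) = ∅ := by
  have hlh := lowHeight_lt_highHeight h0 h1
  have hh := highHeight_neg h0 h1
  rcases mul_sub_nonneg_cases hlow with h2 | h2
  · refine inter_interior_eq_empty_of_Icc h0 h1 ⟨min_le_left _ _, h2.1⟩ ⟨min_le_right _ _, h2.2⟩ ?_
    rintro h ⟨-, h3⟩ (⟨h4, h5⟩ | ⟨h4, h5⟩) <;> linarith
  rcases mul_sub_nonneg_cases hhigh with h3 | h3
  · rcases height_eq_of_mem_band h0 h1 hl hl' ⟨h2.1, h3.1⟩ ⟨h2.2, h3.2⟩ with ⟨h4, h5⟩ | ⟨h4, h5⟩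
    all_goals
      refine inter_interior_eq_empty_of_Icc h0 h1 ⟨h4.ge, h4.le⟩ ⟨h5.ge, h5.le⟩ ?_
      rintro h ⟨h6, h7⟩ (⟨h8, h9⟩ | ⟨h8, h9⟩) <;> linarith
  rcases mul_sub_nonneg_cases hhigh' with h4 | h4
  · refine inter_interior_eq_empty_of_Icc h0 h1 ⟨h3.1, h4.1⟩ ⟨h3.2, h4.2⟩ ?_
    rintro h ⟨h6, h7⟩ (⟨h8, h9⟩ | ⟨h8, h9⟩) <;> linarith
  rcases mul_sub_nonneg_cases hlow' with h5 | h5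
  · have hlen : chordLen s(antip x, antip y) = chordLen s(x, y) := chordLen_antip s(x, y)
    have hb := height_eq_of_mem_band (m := a + t / 2) (x := antip x) (y := antip y) h0 h1
      (by rwa [hlen]) (by rwa [hlen])
    simp only [height_antip, mem_Icc] at hb
    rcases hb ⟨by linarith, by linarith⟩ ⟨by linarith, by linarith⟩ with ⟨h6, h7⟩ | ⟨h6, h7⟩
    · refine inter_interior_eq_empty_of_Icc (p := -lowHeight t) (q := -lowHeight t) h0 h1
        ⟨by linarith, by linarith⟩ ⟨by linarith, by linarith⟩ ?_
      rintro h ⟨h8, h9⟩ (⟨h10, h11⟩ | ⟨h10, h11⟩) <;> linarith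
    · refine inter_interior_eq_empty_of_Icc (p := -highHeight t) (q := -highHeight t) h0 h1
        ⟨by linarith, by linarith⟩ ⟨by linarith, by linarith⟩ ?_
      rintro h ⟨h8, h9⟩ (⟨h10, h11⟩ | ⟨h10, h11⟩) <;> linarith
  · refine inter_interior_eq_empty_of_Icc h0 h1 ⟨h5.1, le_max_left _ _⟩ ⟨h5.2, le_max_right _ _⟩ ?_
    rintro h ⟨h6, h7⟩ (⟨h8, h9⟩ | ⟨h8, h9⟩) <;> linarith

lemma cmap_iterate_succ (f : S1 → S1) (i : ℕ) (ℓ : Chord) :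
    cmap f^[i + 1] ℓ = cmap f (cmap f^[i] ℓ) := by
  induction ℓ using Sym2.ind with
  | _ x y => simp only [cmap_mk, Function.iterate_succ_apply']

lemma cmap_iterate_zero (f : S1 → S1) (ℓ : Chord) : cmap f^[0] ℓ = ℓ := by
  induction ℓ using Sym2.ind with
  | _ x y => rfl

lemma isDiag_cmap {ℓ : Chord} (f : S1 → S1) (h : ℓ.IsDiag) : (cmap f ℓ).IsDiag := by
  induction ℓ using Sym2.ind with
  | _ x y =>
    obtain rfl : x = y := h
    rfl

lemma IsInvLam.cmap_iterate {L : Set Chord} (hL : IsInvLam L) {ℓ : Chord} (hℓ : ℓ ∈ L) (i : ℕ) :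
    cmap s3^[i] ℓ ∈ L ∨ (cmap s3^[i] ℓ).IsDiag := by
  induction i with
  | zero => rw [cmap_iterate_zero]; exact Or.inl hℓ
  | succ i ih =>
    rw [cmap_iterate_succ]
    rcases ih with h | h
    · exact hL.forward _ h
    · exact Or.inr (isDiag_cmap _ h)

lemma IsInvLam.not_crosses_iterate {L : Set Chord} (hL : IsInvLam L) {ℓ ℓ' : Chord} (hℓ : ℓ ∈ L)
    (hℓ' : ℓ' ∈ L) (i j : ℕ) : ¬ Crosses (cmap s3^[i] ℓ) (cmap s3^[j] ℓ') := by
  rcases hL.cmap_iterate hℓ i with h | h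
  · rcases hL.cmap_iterate hℓ' j with h' | h'
    · exact hL.nocross _ h _ h'
    · exact (not_crosses_of_isDiag h').2
  · exact (not_crosses_of_isDiag h).1

/-- The two long siblings of a nondegenerate comajor are leaves, and no leaf is closer in length
to `1/3`. -/
lemma IsComajor.siblings_mem {L : Set Chord} (hL : IsCubicSymLam L) {a t : ℝ} (h0 : 0 < t)
    (h1 : t < 1 / 6) (hc : IsComajor L s((a : S1), ((a + t : ℝ) : S1))) :
    (∀ ℓ ∈ L, t ≤ |1 / 3 - chordLen ℓ|) ∧
    s(((a + 1 / 3 : ℝ) : S1), ((a + t + 2 / 3 : ℝ) : S1)) ∈ L ∧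
    s(((a + 2 / 3 : ℝ) : S1), ((a + t + 1 / 3 : ℝ) : S1)) ∈ L := by
  have hlen : chordLen s((a : S1), ((a + t : ℝ) : S1)) = t := by
    simpa using chordLen_sibling_eq (a := a) h0 h1 0
  have hnd : ¬ (s((a : S1), ((a + t : ℝ) : S1)) : Chord).IsDiag := by
    intro h
    have h' : (a : S1) = ((a + t : ℝ) : S1) := h
    rw [chordLen_mk, h', sub_self, norm_zero] at hlen
    linarith
  obtain ⟨-, hmem, ⟨M, hM, hMc⟩, hdisj⟩ := hc
  have hcL := hmem hnd
  obtain ⟨i, j, hi, hj, rfl⟩ := chord_fiber hMc.symm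
  have hij : i ≠ j := by
    rintro rfl
    refine not_disjoint_of_common _ _ _ (hdisj _ ⟨hcL, fun ℓ hℓ => ?_⟩)
    have := hM.2 ℓ hℓ
    rw [chordLen_sibling_eq h0 h1] at this
    rwa [hlen]
  have hmin : ∀ ℓ ∈ L, t ≤ |1 / 3 - chordLen ℓ| := fun ℓ hℓ => by
    have := hM.2 ℓ hℓ
    rwa [chordLen_sibling_ne h0 h1 hi hj hij] at this
  have hne : ∀ i j : ℕ, i < 3 → j < 3 → i ≠ j →
      s(((a + i / 3 : ℝ) : S1), ((a + t + j / 3 : ℝ) : S1)) ∈ L → i ≠ 0 ∧ j ≠ 0 := by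
    intro i j hi hj hij hmem
    have hd := hdisj _ ⟨hmem, fun ℓ hℓ => by
      rw [chordLen_sibling_ne h0 h1 hi hj hij]; exact hmin ℓ hℓ⟩
    constructor
    · rintro rfl
      simp only [Nat.cast_zero, zero_div, add_zero] at hd
      exact not_disjoint_of_common _ _ _ hd
    · rintro rfl
      simp only [Nat.cast_zero, zero_div, add_zero] at hd
      rw [Sym2.eq_swap (a := (a : S1)), Sym2.eq_swap (b := ((a + t : ℝ) : S1))] at hd
      exact not_disjoint_of_common _ _ _ hd
  have himg : ¬ (cmap s3 s(((a + i / 3 : ℝ) : S1), ((a + t + j / 3 : ℝ) : S1))).IsDiag := by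
    rw [← hMc, cmap_mk, s3_coe, s3_coe]
    intro h
    obtain ⟨n, hn⟩ := exists_int_of_coe_eq (h : ((3 * a : ℝ) : S1) = ((3 * (a + t) : ℝ) : S1))
    have e1 : (-1 : ℝ) < n := by linarith
    have e2 : (n : ℝ) < 0 := by linarith
    have e1' : -1 < n := by exact_mod_cast e1
    have e2' : n < 0 := by exact_mod_cast e2
    omega
  obtain ⟨ℓ₂, h2L, ℓ₃, h3L, d12, d13, d23, -, e2, e3⟩ := hL.siblings _ hM.1 himg
  obtain ⟨i₂, j₂, hi₂, hj₂, rfl⟩ := chord_fiber (e2.trans hMc.symm)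
  obtain ⟨i₃, j₃, hi₃, hj₃, rfl⟩ := chord_fiber (e3.trans hMc.symm)
  have hi' : ∀ {i j i' j' : ℕ}, Disjoint
      (chordSet s(((a + i / 3 : ℝ) : S1), ((a + t + j / 3 : ℝ) : S1)))
      (chordSet s(((a + i' / 3 : ℝ) : S1), ((a + t + j' / 3 : ℝ) : S1))) → i ≠ i' ∧ j ≠ j' := by
    intro i j i' j' hd
    constructor
    · rintro rfl
      exact not_disjoint_of_common _ _ _ hd
    · rintro rfl
      rw [Sym2.eq_swap, Sym2.eq_swap (a := ((a + i' / 3 : ℝ) : S1))] at hd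
      exact not_disjoint_of_common _ _ _ hd
  have n1 := hne i j hi hj hij hM.1
  have n2 := fun h => hne i₂ j₂ hi₂ hj₂ h h2L
  have n3 := fun h => hne i₃ j₃ hi₃ hj₃ h h3L
  have s12 := hi' d12
  have s13 := hi' d13
  have s23 := hi' d23
  have h1L := hM.1
  have hcast : ∀ i j : ℕ, s(((a + i / 3 : ℝ) : S1), ((a + t + j / 3 : ℝ) : S1)) ∈ L →
      ∀ i' j' : ℕ, i = i' → j = j' →
      s(((a + i' / 3 : ℝ) : S1), ((a + t + j' / 3 : ℝ) : S1)) ∈ L := by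
    rintro i j h _ _ rfl rfl
    exact h
  have hboth : (∃ i j : ℕ, s(((a + i / 3 : ℝ) : S1), ((a + t + j / 3 : ℝ) : S1)) ∈ L ∧
      i = 1 ∧ j = 2) ∧ (∃ i j : ℕ, s(((a + i / 3 : ℝ) : S1), ((a + t + j / 3 : ℝ) : S1)) ∈ L ∧
      i = 2 ∧ j = 1) := by
    constructor
    · by_cases c1 : i = 1
      · exact ⟨i, j, h1L, c1, by omega⟩
      by_cases c2 : i₂ = 1
      · exact ⟨i₂, j₂, h2L, c2, by omega⟩
      · exact ⟨i₃, j₃, h3L, by omega, by omega⟩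
    · by_cases c1 : i = 2
      · exact ⟨i, j, h1L, c1, by omega⟩
      by_cases c2 : i₂ = 2
      · exact ⟨i₂, j₂, h2L, c2, by omega⟩
      · exact ⟨i₃, j₃, h3L, by omega, by omega⟩
  obtain ⟨⟨_, _, hA, rfl, rfl⟩, ⟨_, _, hB, rfl, rfl⟩⟩ := hboth
  push_cast at hA hB
  exact ⟨hmin, hA, hB⟩

lemma isLegalPair_of_isComajor {L : Set Chord} (hL : IsCubicSymLam L) {c : Chord}
    (hc : IsComajor L c) : IsLegalPair c := by
  by_cases hd : c.IsDiag
  · exact Or.inl hd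
  have hlt : chordLen c < 1 / 6 := hc.1.resolve_right hd
  obtain ⟨a, t, h0, h1, ht, rfl⟩ := exists_coordinates hd hlt
  have hcL := hc.2.1 hd
  have hcL' := hL.symm _ hcL
  refine Or.inr ⟨a, t, h0, h1, ht, rfl, fun i j => ⟨?_, ?_, ?_⟩, fun i hi => ?_⟩
  · exact hL.not_crosses_iterate hcL hcL i j
  · exact hL.not_crosses_iterate hcL hcL' i j
  · exact hL.not_crosses_iterate hcL' hcL' i j
  obtain ⟨hmin, hA, hB⟩ := hc.siblings_mem hL h0 h1
  have hiter : ∀ i, cmap s3^[i] s((a : S1), ((a + t : ℝ) : S1)) ∈ L ∧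
      t ≤ chordLen (cmap s3^[i] s((a : S1), ((a + t : ℝ) : S1))) := by
    intro i
    induction i with
    | zero => rw [cmap_iterate_zero]; exact ⟨hcL, ht.le⟩
    | succ i ih =>
      rw [cmap_iterate_succ]
      have h3 := chordLen_cmap_s3_ge ih.2 (hmin _ ih.1)
      refine ⟨(hL.forward _ ih.1).resolve_right fun h => ?_, by linarith⟩
      revert h h3
      generalize cmap s3 (cmap s3^[i] s((a : S1), ((a + t : ℝ) : S1))) = ℓ
      induction ℓ using Sym2.ind with
      | _ x y =>
        intro h3 h
        obtain rfl : x = y := h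
        rw [chordLen_mk, sub_self, norm_zero] at h3
        linarith
  obtain ⟨k, rfl⟩ : ∃ k, i = k + 1 := ⟨i - 1, by omega⟩
  have hmem := (hiter (k + 1)).1
  have hlen := chordLen_cmap_s3_ge (hiter k).2 (hmin _ (hiter k).1)
  rw [← cmap_iterate_succ] at hlen
  revert hmem hlen
  generalize cmap s3^[k + 1] s((a : S1), ((a + t : ℝ) : S1)) = ℓ
  induction ℓ using Sym2.ind with
  | _ x y =>
    intro hmem hlen
    have hmem' := hL.symm _ hmem
    have hlow : ∀ x y : S1, s(x, y) ∈ L → 0 ≤ (lowHeight t - height (a + t / 2) (toC x)) *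
        (lowHeight t - height (a + t / 2) (toC y)) := by
      intro x y hxy
      have := (not_crosses_iff _ _ _ _).1 (hL.nocross _ hB _ hxy)
      rw [show a + t + 1 / 3 = a + t / 2 + (1 / 3 + t / 2) by ring,
        coe_eq_coe (x := a + 2 / 3) (y := a + t / 2 - (1 / 3 + t / 2)) 1 (by push_cast; ring),
        crossForm_swap_left, crossForm_horizontal] at this
      exact (mul_nonneg_iff_of_pos_left two_pos).1 this
    have hhigh : ∀ x y : S1, s(x, y) ∈ L → 0 ≤ (highHeight t - height (a + t / 2) (toC x)) *
        (highHeight t - height (a + t / 2) (toC y)) := by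
      intro x y hxy
      have := (not_crosses_iff _ _ _ _).1 (hL.nocross _ hA _ hxy)
      rw [show a + 1 / 3 = a + t / 2 + (1 / 3 - t / 2) by ring,
        coe_eq_coe (x := a + t + 2 / 3) (y := a + t / 2 - (1 / 3 - t / 2)) 1 (by push_cast; ring),
        crossForm_horizontal] at this
      exact (mul_nonneg_iff_of_pos_left two_pos).1 this
    have h5 := hlow _ _ hmem'
    have h6 := hhigh _ _ hmem'
    rw [height_antip, height_antip] at h5 h6
    exact inter_interior_eq_empty h0 h1 hlen (hmin _ hmem) (hlow _ _ hmem) (hhigh _ _ hmem)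
      (by linarith) (by linarith)

/-! ### Pairs of points compatible with the strips -/

/-- The six arcs cut out by the strips over a chord of length `t`, apart from the two arcs between
the strips, in coordinates relative to the midpoint of the chord. -/
def arcBounds (t : ℝ) : Set (ℝ × ℝ) :=
  {(-(1 / 6 - t / 2), 1 / 6 - t / 2), (1 / 6 - t / 2, 1 / 6 + t / 2),
    (1 / 3 - t / 2, 1 / 3 + t / 2), (1 / 3 + t / 2, 2 / 3 - t / 2),
    (2 / 3 - t / 2, 2 / 3 + t / 2), (5 / 6 - t / 2, 5 / 6 + t / 2)}

/-- The two arcs between the strips. -/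
def midArcs (m t : ℝ) : Set S1 :=
  arc m (1 / 6 + t / 2) (1 / 3 - t / 2) ∪ arc m (2 / 3 + t / 2) (5 / 6 - t / 2)

/-- The pairs of points whose chord does not enter the interiors of the strips, or which lie in a
common boundary arc of the strips. -/
def compat (m t : ℝ) : Set (S1 × S1) :=
  (⋃ I ∈ arcBounds t, arc m I.1 I.2 ×ˢ arc m I.1 I.2) ∪ midArcs m t ×ˢ midArcs m t

lemma isCompact_midArcs (m t : ℝ) : IsCompact (midArcs m t) :=
  (isCompact_arc _ _ _).union (isCompact_arc _ _ _)

lemma isClosed_compat (m t : ℝ) : IsClosed (compat m t) := by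
  refine IsClosed.union (Set.Finite.isClosed_biUnion ?_ fun I _ => ?_) ?_
  · unfold arcBounds
    exact Set.toFinite _
  · exact (isCompact_arc _ _ _).isClosed.prod (isCompact_arc _ _ _).isClosed
  · exact (isCompact_midArcs _ _).isClosed.prod (isCompact_midArcs _ _).isClosed

lemma mem_compat_of_arc {m t : ℝ} {I : ℝ × ℝ} (hI : I ∈ arcBounds t) {x y : S1}
    (hx : x ∈ arc m I.1 I.2) (hy : y ∈ arc m I.1 I.2) : (x, y) ∈ compat m t :=
  Or.inl (mem_biUnion hI ⟨hx, hy⟩)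

lemma compat_cases {m t : ℝ} {z : S1 × S1} (hz : z ∈ compat m t) :
    (∃ I ∈ arcBounds t, z.1 ∈ arc m I.1 I.2 ∧ z.2 ∈ arc m I.1 I.2) ∨
      z.1 ∈ midArcs m t ∧ z.2 ∈ midArcs m t := by
  rcases hz with h | h
  · obtain ⟨I, hI, h⟩ := mem_iUnion₂.1 h
    exact Or.inl ⟨I, hI, h⟩
  · exact Or.inr h

lemma swap_mem_compat {m t : ℝ} {x y : S1} (h : (x, y) ∈ compat m t) : (y, x) ∈ compat m t := by
  rcases compat_cases h with ⟨I, hI, h1, h2⟩ | ⟨h1, h2⟩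
  · exact mem_compat_of_arc hI h2 h1
  · exact Or.inr ⟨h2, h1⟩

lemma antip_mem_midArcs {m t : ℝ} {x : S1} (h : x ∈ midArcs m t) : antip x ∈ midArcs m t := by
  rcases h with ⟨θ, ⟨h1, h2⟩, rfl⟩ | ⟨θ, ⟨h1, h2⟩, rfl⟩
  · simp only [antip_coe]
    exact Or.inr (mem_arc_of_eq (θ := θ + 1 / 2) 0 (by push_cast; ring) (by linarith) (by linarith))
  · simp only [antip_coe]
    exact Or.inl (mem_arc_of_eq (θ := θ - 1 / 2) 1 (by push_cast; ring) (by linarith) (by linarith))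

lemma exists_antip_arc {m t : ℝ} {I : ℝ × ℝ} (hI : I ∈ arcBounds t) :
    ∃ J ∈ arcBounds t, ∀ x ∈ arc m I.1 I.2, antip x ∈ arc m J.1 J.2 := by
  have up : ∀ J : ℝ × ℝ, J.1 = I.1 + 1 / 2 → J.2 = I.2 + 1 / 2 →
      ∀ x ∈ arc m I.1 I.2, antip x ∈ arc m J.1 J.2 := by
    rintro J e1 e2 x ⟨θ, ⟨h1, h2⟩, rfl⟩
    simp only [antip_coe]
    exact mem_arc_of_eq (θ := θ + 1 / 2) 0 (by push_cast; ring) (by linarith) (by linarith)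
  have down : ∀ J : ℝ × ℝ, J.1 = I.1 - 1 / 2 → J.2 = I.2 - 1 / 2 →
      ∀ x ∈ arc m I.1 I.2, antip x ∈ arc m J.1 J.2 := by
    rintro J e1 e2 x ⟨θ, ⟨h1, h2⟩, rfl⟩
    simp only [antip_coe]
    exact mem_arc_of_eq (θ := θ - 1 / 2) 1 (by push_cast; ring) (by linarith) (by linarith)
  rcases hI with rfl | rfl | rfl | rfl | rfl | rfl
  · exact ⟨(1 / 3 + t / 2, 2 / 3 - t / 2), by simp [arcBounds],
      up _ (by dsimp only; ring) (by dsimp only; ring)⟩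
  · exact ⟨(2 / 3 - t / 2, 2 / 3 + t / 2), by simp [arcBounds],
      up _ (by dsimp only; ring) (by dsimp only; ring)⟩
  · exact ⟨(5 / 6 - t / 2, 5 / 6 + t / 2), by simp [arcBounds],
      up _ (by dsimp only; ring) (by dsimp only; ring)⟩
  · exact ⟨(-(1 / 6 - t / 2), 1 / 6 - t / 2), by simp [arcBounds],
      down _ (by dsimp only; ring) (by dsimp only; ring)⟩
  · exact ⟨(1 / 6 - t / 2, 1 / 6 + t / 2), by simp [arcBounds],
      down _ (by dsimp only; ring) (by dsimp only; ring)⟩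
  · exact ⟨(1 / 3 - t / 2, 1 / 3 + t / 2), by simp [arcBounds],
      down _ (by dsimp only; ring) (by dsimp only; ring)⟩

lemma antip_mem_compat {m t : ℝ} {x y : S1} (h : (x, y) ∈ compat m t) :
    (antip x, antip y) ∈ compat m t := by
  rcases compat_cases h with ⟨I, hI, h1, h2⟩ | ⟨h1, h2⟩
  · obtain ⟨J, hJ, hJ'⟩ := exists_antip_arc (m := m) hI
    exact mem_compat_of_arc hJ (hJ' _ h1) (hJ' _ h2)
  · exact Or.inr ⟨antip_mem_midArcs h1, antip_mem_midArcs h2⟩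

/-- Two pairs, one inside an arc and one outside its interior, are not linked. -/
lemma crossForm_nonneg_of_arc {m p q r : ℝ} (hp : r ≤ p) (hq : q ≤ r + 1) {θ φ η ζ : ℝ}
    (hθ : θ ∈ Icc p q) (hφ : φ ∈ Icc p q) (hη : η ∈ Icc r (r + 1)) (hζ : ζ ∈ Icc r (r + 1))
    (hη' : η ≤ p ∨ q ≤ η) (hζ' : ζ ≤ p ∨ q ≤ ζ) :
    0 ≤ crossForm ((m + θ : ℝ) : S1) ((m + φ : ℝ) : S1) ((m + η : ℝ) : S1) ((m + ζ : ℝ) : S1) := by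
  have key : ∀ η ∈ Icc r (r + 1), (η ≤ p ∨ q ≤ η) →
      ∃ η' : ℝ, ((m + η : ℝ) : S1) = ((m + η' : ℝ) : S1) ∧ q ≤ η' ∧ η' ≤ p + 1 := by
    rintro η ⟨h1, h2⟩ (h | h)
    · exact ⟨η + 1, (coe_eq_coe 1 (by push_cast; ring)).symm, by linarith, by linarith⟩
    · exact ⟨η, rfl, h, by linarith⟩
  obtain ⟨η', e1, h1, h2⟩ := key η hη hη'
  obtain ⟨ζ', e2, h3, h4⟩ := key ζ hζ hζ'
  rw [e1, e2]
  obtain ⟨h5, h6⟩ := hθ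
  obtain ⟨h7, h8⟩ := hφ
  apply crossForm_nonneg_of_le <;> linarith

lemma arcBounds_subset {t : ℝ} (h0 : 0 < t) (h1 : t < 1 / 6) {I : ℝ × ℝ} (hI : I ∈ arcBounds t) :
    -(1 / 6 - t / 2) ≤ I.1 ∧ I.2 ≤ -(1 / 6 - t / 2) + 1 ∧ I.2 - I.1 < 1 / 3 := by
  rcases hI with rfl | rfl | rfl | rfl | rfl | rfl <;> dsimp only <;>
    refine ⟨?_, ?_, ?_⟩ <;> linarith

lemma arcBounds_separated {t : ℝ} (h0 : 0 < t) (h1 : t < 1 / 6) {I J : ℝ × ℝ}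
    (hI : I ∈ arcBounds t) (hJ : J ∈ arcBounds t) : I = J ∨ J.2 ≤ I.1 ∨ I.2 ≤ J.1 := by
  rcases hI with rfl | rfl | rfl | rfl | rfl | rfl <;>
    rcases hJ with rfl | rfl | rfl | rfl | rfl | rfl <;> dsimp only <;>
    first
    | exact Or.inl rfl
    | exact Or.inr (Or.inl (by linarith))
    | exact Or.inr (Or.inr (by linarith))

lemma mem_midArcs {m t : ℝ} {x : S1} (h : x ∈ midArcs m t) : ∃ θ : ℝ, x = ((m + θ : ℝ) : S1) ∧
    ((1 / 6 + t / 2 ≤ θ ∧ θ ≤ 1 / 3 - t / 2) ∨ (2 / 3 + t / 2 ≤ θ ∧ θ ≤ 5 / 6 - t / 2)) := by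
  rcases h with ⟨θ, ⟨h1, h2⟩, rfl⟩ | ⟨θ, ⟨h1, h2⟩, rfl⟩
  · exact ⟨θ, rfl, Or.inl ⟨h1, h2⟩⟩
  · exact ⟨θ, rfl, Or.inr ⟨h1, h2⟩⟩

lemma midArcs_separated {t : ℝ} (h0 : 0 < t) (h1 : t < 1 / 6) {I : ℝ × ℝ}
    (hI : I ∈ arcBounds t) {θ : ℝ}
    (hθ : (1 / 6 + t / 2 ≤ θ ∧ θ ≤ 1 / 3 - t / 2) ∨ (2 / 3 + t / 2 ≤ θ ∧ θ ≤ 5 / 6 - t / 2)) :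
    (θ ≤ I.1 ∨ I.2 ≤ θ) ∧ θ ∈ Icc (-(1 / 6 - t / 2)) (-(1 / 6 - t / 2) + 1) := by
  refine ⟨?_, ?_⟩
  · rcases hI with rfl | rfl | rfl | rfl | rfl | rfl <;> dsimp only <;>
      rcases hθ with ⟨h2, h3⟩ | ⟨h2, h3⟩ <;>
      first
      | exact Or.inl (by linarith)
      | exact Or.inr (by linarith)
  · rcases hθ with ⟨h2, h3⟩ | ⟨h2, h3⟩ <;> exact ⟨by linarith, by linarith⟩

lemma one_add_two_mul_cos_pos {d : ℝ} (h : |d| < 1 / 3) :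
    0 < 1 + 2 * Real.cos (2 * Real.pi * d) := by
  have := cos_lt_cos_of_lt (abs_nonneg d) h (by norm_num)
  rw [cos_two_pi_abs, show 2 * Real.pi * (1 / 3) = Real.pi - Real.pi / 3 by ring,
    Real.cos_pi_sub, Real.cos_pi_div_three] at this
  linarith

lemma one_add_two_mul_cos_neg {d : ℝ} (h1 : 1 / 3 < d) (h2 : d < 2 / 3) :
    1 + 2 * Real.cos (2 * Real.pi * d) < 0 := by
  have := cos_lt_cos_of_lt (abs_nonneg (1 / 2 - d))
    (abs_lt.2 ⟨by linarith, by linarith⟩ : |1 / 2 - d| < 1 / 6) (by norm_num)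
  rw [cos_two_pi_abs, show 2 * Real.pi * (1 / 6) = Real.pi / 3 by ring, Real.cos_pi_div_three,
    show 2 * Real.pi * (1 / 2 - d) = Real.pi - 2 * Real.pi * d by ring, Real.cos_pi_sub] at this
  linarith

/-- If points carry signs governing the expansion factor of `s3`, links persist under `s3`. -/
lemma crossForm_s3_neg_of_sign {x y u v : S1} (e : S1 → ℝ) {A : Set S1}
    (he : ∀ x ∈ A, e x = 1 ∨ e x = -1)
    (hpos : ∀ x ∈ A, ∀ u ∈ A, 0 < (1 + 2 * (toC (x - u)).re) * (e x * e u))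
    (hx : x ∈ A) (hy : y ∈ A) (hu : u ∈ A) (hv : v ∈ A) (h : crossForm x y u v < 0) :
    crossForm (s3 x) (s3 y) (s3 u) (s3 v) < 0 := by
  rw [crossForm_s3]
  refine mul_neg_of_neg_of_pos h ?_
  have h1 := mul_pos (mul_pos (mul_pos (hpos x hx u hu) (hpos x hx v hv)) (hpos y hy u hu))
    (hpos y hy v hv)
  have sq : ∀ x ∈ A, e x ^ 2 = 1 := fun x hx => by rcases he x hx with h | h <;> rw [h] <;> norm_num
  have h2 : (1 + 2 * (toC (x - u)).re) * (1 + 2 * (toC (x - v)).re) *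
      (1 + 2 * (toC (y - u)).re) * (1 + 2 * (toC (y - v)).re) *
      (e x ^ 2 * e y ^ 2 * e u ^ 2 * e v ^ 2) =
      (1 + 2 * (toC (x - u)).re) * (e x * e u) * ((1 + 2 * (toC (x - v)).re) * (e x * e v)) *
      ((1 + 2 * (toC (y - u)).re) * (e y * e u)) * ((1 + 2 * (toC (y - v)).re) * (e y * e v)) := by
    ring
  rw [sq x hx, sq y hy, sq u hu, sq v hv] at h2
  linarith

open Classical in
lemma crossForm_s3_neg {m t : ℝ} (h0 : 0 < t) (h1 : t < 1 / 6) {x y u v : S1}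
    (hz : (x, y) ∈ compat m t) (hw : (u, v) ∈ compat m t) (h : crossForm x y u v < 0) :
    crossForm (s3 x) (s3 y) (s3 u) (s3 v) < 0 := by
  have hmix : ∀ {I : ℝ × ℝ} {x y u v : S1}, I ∈ arcBounds t → x ∈ arc m I.1 I.2 →
      y ∈ arc m I.1 I.2 → u ∈ midArcs m t → v ∈ midArcs m t → 0 ≤ crossForm x y u v := by
    rintro I _ _ u v hI ⟨θ, hθ, rfl⟩ ⟨φ, hφ, rfl⟩ hu hv
    obtain ⟨η, rfl, hη⟩ := mem_midArcs hu
    obtain ⟨ζ, rfl, hζ⟩ := mem_midArcs hv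
    obtain ⟨h2, h3, -⟩ := arcBounds_subset h0 h1 hI
    obtain ⟨h4, h5⟩ := midArcs_separated h0 h1 hI hη
    obtain ⟨h6, h7⟩ := midArcs_separated h0 h1 hI hζ
    exact crossForm_nonneg_of_arc h2 h3 hθ hφ h5 h7 h4 h6
  rcases compat_cases hz with ⟨I, hI, hx, hy⟩ | ⟨hx, hy⟩ <;>
    rcases compat_cases hw with ⟨J, hJ, hu, hv⟩ | ⟨hu, hv⟩
  · obtain ⟨h2, h3, hlen⟩ := arcBounds_subset h0 h1 hI
    obtain ⟨h4, h5, -⟩ := arcBounds_subset h0 h1 hJ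
    by_cases hIJ : I = J
    · subst hIJ
      refine crossForm_s3_neg_of_sign (fun _ => 1) (fun _ _ => Or.inl rfl) ?_ hx hy hu hv h
      rintro _ ⟨θ, ⟨h6, h7⟩, rfl⟩ _ ⟨φ, ⟨h8, h9⟩, rfl⟩
      simp only [mul_one]
      rw [← AddCircle.coe_sub, toC_coe_re]
      exact one_add_two_mul_cos_pos (abs_lt.2 ⟨by linarith, by linarith⟩)
    · refine absurd h (not_lt.2 ?_)
      have hsep := (arcBounds_separated h0 h1 hI hJ).resolve_left hIJ
      obtain ⟨θ, hθ, rfl⟩ := hx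
      obtain ⟨φ, hφ, rfl⟩ := hy
      obtain ⟨η, hη, rfl⟩ := hu
      obtain ⟨ζ, hζ, rfl⟩ := hv
      refine crossForm_nonneg_of_arc h2 h3 hθ hφ ⟨by linarith [hη.1], by linarith [hη.2]⟩
        ⟨by linarith [hζ.1], by linarith [hζ.2]⟩ ?_ ?_
      · exact hsep.imp (fun h => hη.2.trans h) (fun h => h.trans hη.1)
      · exact hsep.imp (fun h => hζ.2.trans h) (fun h => h.trans hζ.1)
  · exact absurd h (not_lt.2 (hmix hI hx hy hu hv))
  · exact absurd h (not_lt.2 (by rw [← crossForm_comm]; exact hmix hJ hu hv hx hy))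
  · refine crossForm_s3_neg_of_sign
      (fun x => if x ∈ arc m (1 / 6 + t / 2) (1 / 3 - t / 2) then 1 else -1)
      (A := midArcs m t) ?_ ?_ hx hy hu hv h
    · intro x _
      split_ifs
      · exact Or.inl rfl
      · exact Or.inr rfl
    · have hnot : ∀ θ : ℝ, 2 / 3 + t / 2 ≤ θ → θ ≤ 5 / 6 - t / 2 →
          ((m + θ : ℝ) : S1) ∉ arc m (1 / 6 + t / 2) (1 / 3 - t / 2) := by
        rintro θ h2 h3 ⟨φ, ⟨h4, h5⟩, e⟩
        obtain ⟨n, hn⟩ := exists_int_of_coe_eq e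
        have e1 : (-1 : ℝ) < n := by linarith
        have e2 : (n : ℝ) < 0 := by linarith
        have e1' : -1 < n := by exact_mod_cast e1
        have e2' : n < 0 := by exact_mod_cast e2
        omega
      intro x hx u hu
      obtain ⟨θ, rfl, hθ⟩ := mem_midArcs hx
      obtain ⟨φ, rfl, hφ⟩ := mem_midArcs hu
      rw [← AddCircle.coe_sub, toC_coe_re, add_sub_add_left_eq_sub]
      rcases hθ with ⟨h2, h3⟩ | ⟨h2, h3⟩ <;> rcases hφ with ⟨h4, h5⟩ | ⟨h4, h5⟩
      · rw [if_pos (mem_arc h2 h3), if_pos (mem_arc h4 h5)]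
        have := one_add_two_mul_cos_pos (d := θ - φ) (abs_lt.2 ⟨by linarith, by linarith⟩)
        linarith
      · rw [if_pos (mem_arc h2 h3), if_neg (hnot _ h4 h5)]
        have := one_add_two_mul_cos_neg (d := φ - θ) (by linarith) (by linarith)
        rw [show 2 * Real.pi * (φ - θ) = -(2 * Real.pi * (θ - φ)) by ring, Real.cos_neg] at this
        linarith
      · rw [if_neg (hnot _ h2 h3), if_pos (mem_arc h4 h5)]
        have := one_add_two_mul_cos_neg (d := θ - φ) (by linarith) (by linarith)
        linarith
      · rw [if_neg (hnot _ h2 h3), if_neg (hnot _ h4 h5)]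
        have := one_add_two_mul_cos_pos (d := θ - φ) (abs_lt.2 ⟨by linarith, by linarith⟩)
        linarith

/-! ### Orbits of legal chords are compatible -/

lemma toC_injective : Function.Injective toC := by
  intro x y h
  obtain ⟨x, -, -, rfl⟩ := exists_lift 0 0 x
  obtain ⟨y, -, -, rfl⟩ := exists_lift 0 0 y
  rw [toC_coe, toC_coe, Complex.exp_eq_exp_iff_exists_int] at h
  obtain ⟨n, hn⟩ := h
  have hpi : (2 * Real.pi * Complex.I : ℂ) ≠ 0 := Complex.two_pi_I_ne_zero
  have h2 : ((0 + x : ℝ) : ℂ) = ((0 + y : ℝ) : ℂ) + n := by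
    apply mul_left_cancel₀ hpi
    rw [hn]; ring
  exact coe_eq_coe n (by exact_mod_cast h2)

lemma norm_toC (x : S1) : ‖toC x‖ = 1 := by
  obtain ⟨x, -, -, rfl⟩ := exists_lift 0 0 x
  rw [toC_coe, show (2 * Real.pi * Complex.I * ((0 + x : ℝ) : ℂ)) =
    ((2 * Real.pi * (0 + x) : ℝ) : ℂ) * Complex.I by push_cast; ring, Complex.norm_exp_ofReal_mul_I]

lemma mem_segment_of_height {m θ : ℝ} {z : ℂ} (hz : ‖z‖ ≤ 1)
    (h : height m z = Real.cos (2 * Real.pi * θ)) (hs : 0 < Real.sin (2 * Real.pi * θ)) :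
    z ∈ segment ℝ (toC ((m + θ : ℝ) : S1)) (toC ((m - θ : ℝ) : S1)) := by
  set S := Real.sin (2 * Real.pi * θ)
  set w := -z.re * Real.sin (2 * Real.pi * m) + z.im * Real.cos (2 * Real.pi * m) with hw
  have hnorm : z.re ^ 2 + z.im ^ 2 ≤ 1 := by
    have h1 := Complex.sq_norm z
    rw [Complex.normSq_apply] at h1
    nlinarith [norm_nonneg z]
  have hm := Real.sin_sq_add_cos_sq (2 * Real.pi * m)
  have hθ : S ^ 2 + Real.cos (2 * Real.pi * θ) ^ 2 = 1 :=
    Real.sin_sq_add_cos_sq (2 * Real.pi * θ)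
  have hsum : w ^ 2 + height m z ^ 2 = z.re ^ 2 + z.im ^ 2 := by
    rw [hw, height]
    linear_combination (z.re ^ 2 + z.im ^ 2) * hm
  have hwS : |w| ≤ S := by
    apply abs_le_of_sq_le_sq _ hs.le
    rw [h] at hsum
    linarith
  obtain ⟨hw1, hw2⟩ := abs_le.1 hwS
  have hre : z.re = height m z * Real.cos (2 * Real.pi * m) - w * Real.sin (2 * Real.pi * m) := by
    rw [hw, height]
    linear_combination (-z.re) * hm
  have him : z.im = height m z * Real.sin (2 * Real.pi * m) + w * Real.cos (2 * Real.pi * m) := by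
    rw [hw, height]
    linear_combination (-z.im) * hm
  have hdiv : w / S * S = w := div_mul_cancel₀ _ hs.ne'
  have hd1 : w / S ≤ 1 := (div_le_one hs).2 hw2
  have hd2 : -1 ≤ w / S := by rw [le_div_iff₀ hs]; linarith
  refine ⟨(1 + w / S) / 2, (1 - w / S) / 2, by linarith, by linarith, by ring, ?_⟩
  have e1 : 2 * Real.pi * (m + θ) = 2 * Real.pi * m + 2 * Real.pi * θ := by ring
  have e2 : 2 * Real.pi * (m - θ) = 2 * Real.pi * m - 2 * Real.pi * θ := by ring
  apply Complex.ext
  · simp only [Complex.add_re, Complex.real_smul, Complex.re_ofReal_mul, toC_coe_re]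
    rw [hre, h, e1, e2, Real.cos_add, Real.cos_sub]
    linear_combination (-Real.sin (2 * Real.pi * m)) * hdiv
  · simp only [Complex.add_im, Complex.real_smul, Complex.im_ofReal_mul, toC_coe_im]
    rw [him, h, e1, e2, Real.sin_add, Real.sin_sub]
    linear_combination (Real.cos (2 * Real.pi * m)) * hdiv

lemma mem_QStrip_of_height {a t : ℝ} (h0 : 0 < t) (h1 : t < 1 / 6) {z : ℂ} (hz : ‖z‖ ≤ 1)
    (h : height (a + t / 2) z ∈ Icc (lowHeight t) (highHeight t)) : z ∈ QStrip a t := by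
  obtain ⟨θ, ⟨h2, h3⟩, h4⟩ : height (a + t / 2) z ∈
      (fun θ : ℝ => Real.cos (2 * Real.pi * θ)) '' Icc (1 / 3 - t / 2) (1 / 3 + t / 2) :=
    intermediate_value_Icc' (by linarith) (by fun_prop) h
  have hs : 0 < Real.sin (2 * Real.pi * θ) := by
    have := sin_pi_pos (d := 2 * θ) (by linarith) (by linarith)
    rwa [show Real.pi * (2 * θ) = 2 * Real.pi * θ by ring] at this
  refine (convex_convexHull ℝ _).segment_subset (subset_convexHull ℝ _ ?_)
    (subset_convexHull ℝ _ ?_) (mem_segment_of_height hz h4.symm hs)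
  · exact Or.inl ⟨a + t / 2 + θ, ⟨by linarith, by linarith⟩, rfl⟩
  · refine Or.inr ⟨a + t / 2 - θ + 1, ⟨by linarith, by linarith⟩, ?_⟩
    rw [circPt, coe_eq_coe (x := a + t / 2 - θ + 1) (y := a + t / 2 - θ) 1 (by push_cast; ring)]

lemma mem_interior_of_height {a t : ℝ} (h0 : 0 < t) (h1 : t < 1 / 6) {z : ℂ} (hz : ‖z‖ < 1)
    (h : height (a + t / 2) z ∈ Ioo (lowHeight t) (highHeight t) ∪
      Ioo (-highHeight t) (-lowHeight t)) :
    z ∈ interior (QStrip a t ∪ QStrip (a + 1 / 2) t) := by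
  have hopen : IsOpen (ball (0 : ℂ) 1 ∩ height (a + t / 2) ⁻¹'
      (Ioo (lowHeight t) (highHeight t) ∪ Ioo (-highHeight t) (-lowHeight t))) :=
    isOpen_ball.inter ((isOpen_Ioo.union isOpen_Ioo).preimage (continuous_height _))
  refine interior_maximal ?_ hopen ⟨by simpa using hz, h⟩
  rintro w ⟨hw, ⟨h2, h3⟩ | ⟨h2, h3⟩⟩
  · exact Or.inl (mem_QStrip_of_height h0 h1 (by simpa using (mem_ball_zero_iff.1 hw).le) ⟨h2.le, h3.le⟩)
  · refine Or.inr (mem_QStrip_of_height h0 h1 (by simpa using (mem_ball_zero_iff.1 hw).le) ?_)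
    rw [show a + 1 / 2 + t / 2 = a + t / 2 + 1 / 2 by ring, height_add_half]
    exact ⟨by linarith, by linarith⟩

lemma exists_combo_mem_Ioo {l h x y : ℝ} (hlh : l < h) (h1 : ¬ (x ≤ l ∧ y ≤ l))
    (h2 : ¬ (h ≤ x ∧ h ≤ y)) :
    ∃ r : ℝ, 0 < r ∧ r < 1 ∧ (1 - r) * x + r * y ∈ Ioo l h := by
  have key : ∀ x y : ℝ, x < y → x < h → l < y →
      ∃ r : ℝ, 0 < r ∧ r < 1 ∧ (1 - r) * x + r * y ∈ Ioo l h := by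
    intro x y hxy hx hy
    have hm : max x l < min y h := max_lt (lt_min hxy hx) (lt_min hy hlh)
    obtain ⟨v, hv1, hv2⟩ := exists_between hm
    obtain ⟨hv3, hv4⟩ := max_lt_iff.1 hv1
    obtain ⟨hv5, hv6⟩ := lt_min_iff.1 hv2
    refine ⟨(v - x) / (y - x), div_pos (by linarith) (by linarith),
      (div_lt_one (by linarith)).2 (by linarith), ?_⟩
    have e : (1 - (v - x) / (y - x)) * x + (v - x) / (y - x) * y = v := by
      have : y - x ≠ 0 := by linarith
      field_simp
      ring
    rw [e]
    exact ⟨hv4, hv6⟩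
  rcases lt_trichotomy x y with hxy | rfl | hxy
  · exact key x y hxy (not_le.1 fun h => h2 ⟨h, by linarith⟩) (not_le.1 fun h => h1 ⟨by linarith, h⟩)
  · refine ⟨1 / 2, by norm_num, by norm_num, ?_⟩
    rw [show (1 - 1 / 2) * x + 1 / 2 * x = x by ring]
    exact ⟨not_le.1 fun h => h1 ⟨h, h⟩, not_le.1 fun h => h2 ⟨h, h⟩⟩
  · obtain ⟨r, hr0, hr1, hr⟩ := key y x hxy (not_le.1 fun h => h2 ⟨by linarith, h⟩)
      (not_le.1 fun h => h1 ⟨h, by linarith⟩)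
    refine ⟨1 - r, by linarith, by linarith, ?_⟩
    rwa [sub_sub_cancel, add_comm]

lemma diag_mem_compat (m t : ℝ) (x : S1) : (x, x) ∈ compat m t := by
  obtain ⟨θ, h2, h3, rfl⟩ := exists_lift m (-(1 / 6 - t / 2)) x
  by_cases hmid : ((m + θ : ℝ) : S1) ∈ midArcs m t
  · exact Or.inr ⟨hmid, hmid⟩
  have hm1 : ¬ (1 / 6 + t / 2 ≤ θ ∧ θ ≤ 1 / 3 - t / 2) := fun h => hmid (Or.inl (mem_arc h.1 h.2))
  have hm2 : ¬ (2 / 3 + t / 2 ≤ θ ∧ θ ≤ 5 / 6 - t / 2) := fun h => hmid (Or.inr (mem_arc h.1 h.2))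
  have key : ∀ I ∈ arcBounds t, I.1 ≤ θ → θ ≤ I.2 →
      (((m + θ : ℝ) : S1), ((m + θ : ℝ) : S1)) ∈ compat m t :=
    fun I hI h4 h5 => mem_compat_of_arc hI (mem_arc h4 h5) (mem_arc h4 h5)
  rcases le_total θ (1 / 6 - t / 2) with h | h
  · exact key (-(1 / 6 - t / 2), 1 / 6 - t / 2) (by simp [arcBounds]) h2 h
  rcases le_total θ (1 / 6 + t / 2) with h' | h'
  · exact key (1 / 6 - t / 2, 1 / 6 + t / 2) (by simp [arcBounds]) h h'
  have h4 : 1 / 3 - t / 2 ≤ θ := (not_le.1 fun h4 => hm1 ⟨h', h4⟩).le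
  rcases le_total θ (1 / 3 + t / 2) with h5 | h5
  · exact key (1 / 3 - t / 2, 1 / 3 + t / 2) (by simp [arcBounds]) h4 h5
  rcases le_total θ (2 / 3 - t / 2) with h6 | h6
  · exact key (1 / 3 + t / 2, 2 / 3 - t / 2) (by simp [arcBounds]) h5 h6
  rcases le_total θ (2 / 3 + t / 2) with h7 | h7
  · exact key (2 / 3 - t / 2, 2 / 3 + t / 2) (by simp [arcBounds]) h6 h7
  have h8 : 5 / 6 - t / 2 ≤ θ := (not_le.1 fun h4 => hm2 ⟨h7, h4⟩).le
  exact key (5 / 6 - t / 2, 5 / 6 + t / 2) (by simp [arcBounds]) h8 (by dsimp only; linarith)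

lemma mem_compat_of_inter_interior {a t : ℝ} (h0 : 0 < t) (h1 : t < 1 / 6) {x y : S1}
    (h : chordSet s(x, y) ∩ interior (QStrip a t ∪ QStrip (a + 1 / 2) t) = ∅) :
    (x, y) ∈ compat (a + t / 2) t := by
  rcases eq_or_ne x y with rfl | hne
  · exact diag_mem_compat _ _ x
  have hlh := lowHeight_lt_highHeight h0 h1
  have hh := highHeight_neg h0 h1
  set m := a + t / 2
  have hball := openSegment_subset_ball_of_ne (x := toC x) (y := toC y) (z := 0) (r := 1)
    (by simp [norm_toC]) (by simp [norm_toC]) (toC_injective.ne hne)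
  have hdich : ∀ l h, l < h → Ioo l h ⊆ Ioo (lowHeight t) (highHeight t) ∪
      Ioo (-highHeight t) (-lowHeight t) → (height m (toC x) ≤ l ∧ height m (toC y) ≤ l) ∨
      (h ≤ height m (toC x) ∧ h ≤ height m (toC y)) := by
    intro l h' hl hsub
    by_contra hcon
    rw [not_or] at hcon
    obtain ⟨r, hr0, hr1, hr⟩ := exists_combo_mem_Ioo hl hcon.1 hcon.2
    have hz : (1 - r) • toC x + r • toC y ∈ openSegment ℝ (toC x) (toC y) :=
      ⟨1 - r, r, by linarith, hr0, by ring, rfl⟩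
    rw [← height_combo] at hr
    have hmem := mem_interior_of_height h0 h1 (by simpa using hball hz) (hsub hr)
    exact Set.eq_empty_iff_forall_notMem.1 h _ ⟨openSegment_subset_segment ℝ _ _ hz, hmem⟩
  have d1 := hdich _ _ hlh subset_union_left
  have d2 := hdich (-highHeight t) (-lowHeight t) (by linarith) subset_union_right
  clear hdich hball h
  obtain ⟨θ, hθ1, hθ2, rfl⟩ := exists_lift m (-1 / 2) x
  obtain ⟨φ, hφ1, hφ2, rfl⟩ := exists_lift m (-1 / 2) y
  have hθ : |θ| ≤ 1 / 2 := abs_le.2 ⟨by linarith, by linarith⟩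
  have hφ : |φ| ≤ 1 / 2 := abs_le.2 ⟨by linarith, by linarith⟩
  rw [height_coe_add, height_coe_add, neg_lowHeight, neg_highHeight] at d2
  rw [height_coe_add, height_coe_add, lowHeight, highHeight] at d1
  rcases d1 with ⟨h2, h3⟩ | ⟨h2, h3⟩
  · have key : ∀ θ : ℝ, -1 / 2 ≤ θ → |θ| ≤ 1 / 2 →
        Real.cos (2 * Real.pi * |θ|) ≤ Real.cos (2 * Real.pi * (1 / 3 + t / 2)) →
        ((m + θ : ℝ) : S1) ∈ arc m (1 / 3 + t / 2) (2 / 3 - t / 2) := by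
      intro θ h4 h5 h6
      have h7 : 1 / 3 + t / 2 ≤ |θ| := by
        rcases le_of_cos_le h6 with h | h | h <;> linarith [abs_nonneg θ]
      rcases le_abs.1 h7 with h | h
      · exact mem_arc h (by linarith [le_abs_self θ])
      · exact mem_arc_of_eq (θ := θ + 1) (-1) (by push_cast; ring) (by linarith) (by linarith)
    exact mem_compat_of_arc (I := (1 / 3 + t / 2, 2 / 3 - t / 2)) (by simp [arcBounds])
      (key θ hθ1 hθ h2) (key φ hφ1 hφ h3)
  rcases d2 with ⟨h4, h5⟩ | ⟨h4, h5⟩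
  · have key : ∀ θ : ℝ,
        Real.cos (2 * Real.pi * (1 / 3 - t / 2)) ≤ Real.cos (2 * Real.pi * |θ|) →
        Real.cos (2 * Real.pi * |θ|) ≤ Real.cos (2 * Real.pi * (1 / 6 + t / 2)) → |θ| ≤ 1 / 2 →
        ((m + θ : ℝ) : S1) ∈ midArcs m t := by
      intro θ h4 h5 h6
      have h7 : |θ| ≤ 1 / 3 - t / 2 := by
        rcases le_of_cos_le h4 with h | h | h <;> linarith [abs_nonneg θ]
      have h8 : 1 / 6 + t / 2 ≤ |θ| := by
        rcases le_of_cos_le h5 with h | h | h <;> linarith [abs_nonneg θ]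
      obtain ⟨h9, h10⟩ := abs_le.1 h7
      rcases le_abs.1 h8 with h | h
      · exact Or.inl (mem_arc h h10)
      · exact Or.inr (mem_arc_of_eq (θ := θ + 1) (-1) (by push_cast; ring) (by linarith)
          (by linarith))
    exact Or.inr ⟨key θ h2 h4 hθ, key φ h3 h5 hφ⟩
  · have key : ∀ θ : ℝ, |θ| ≤ 1 / 2 →
        Real.cos (2 * Real.pi * (1 / 6 - t / 2)) ≤ Real.cos (2 * Real.pi * |θ|) →
        ((m + θ : ℝ) : S1) ∈ arc m (-(1 / 6 - t / 2)) (1 / 6 - t / 2) := by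
      intro θ h3 h4
      have h7 : |θ| ≤ 1 / 6 - t / 2 := by
        rcases le_of_cos_le h4 with h | h | h <;> linarith [abs_nonneg θ]
      exact mem_arc (abs_le.1 h7).1 (abs_le.1 h7).2
    exact mem_compat_of_arc (I := (-(1 / 6 - t / 2), 1 / 6 - t / 2)) (by simp [arcBounds])
      (key θ hθ h4) (key φ hφ h5)

/-! ### Maximal invariant families -/

/-- A symmetric, forward invariant, unlinked family of compatible pairs. -/
structure IsGood (m t : ℝ) (R : Set (S1 × S1)) : Prop where
  sub : R ⊆ compat m t
  nocross : ∀ z ∈ R, ∀ w ∈ R, 0 ≤ crossForm z.1 z.2 w.1 w.2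
  fwd : ∀ z ∈ R, (s3 z.1, s3 z.2) ∈ R
  anti : ∀ z ∈ R, (antip z.1, antip z.2) ∈ R
  swap : ∀ z ∈ R, (z.2, z.1) ∈ R

lemma continuous_s3 : Continuous s3 := continuous_id.nsmul 3

lemma continuous_antip : Continuous antip := continuous_id.add continuous_const

lemma forall_mem_closure_of_continuous {R : Set (S1 × S1)} {f : S1 × S1 → S1 × S1}
    (hf : Continuous f) (h : ∀ z ∈ R, f z ∈ R) : ∀ z ∈ closure R, f z ∈ closure R :=
  fun _ hz => map_mem_closure hf hz h

lemma nonneg_of_mem_closure_prod {X Y : Type*} [TopologicalSpace X] [TopologicalSpace Y]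
    {f : X × Y → ℝ} (hf : Continuous f) {R : Set X} {R' : Set Y}
    (h : ∀ z ∈ R, ∀ w ∈ R', 0 ≤ f (z, w)) {z : X} {w : Y} (hz : z ∈ closure R)
    (hw : w ∈ closure R') : 0 ≤ f (z, w) := by
  have hmem : (z, w) ∈ closure (R ×ˢ R') := by
    rw [closure_prod_eq]
    exact ⟨hz, hw⟩
  exact isClosed_Ici.closure_subset (map_mem_closure hf hmem fun p hp => h _ hp.1 _ hp.2)

lemma crossForm_nonneg_of_mem_closure {R : Set (S1 × S1)}
    (hR : ∀ z ∈ R, ∀ w ∈ R, 0 ≤ crossForm z.1 z.2 w.1 w.2) {z w : S1 × S1}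
    (hz : z ∈ closure R) (hw : w ∈ closure R) : 0 ≤ crossForm z.1 z.2 w.1 w.2 :=
  nonneg_of_mem_closure_prod continuous_crossForm hR hz hw

lemma IsGood.closure {m t : ℝ} {R : Set (S1 × S1)} (hR : IsGood m t R) :
    IsGood m t (closure R) where
  sub := closure_minimal hR.sub (isClosed_compat m t)
  nocross := fun _ hz _ hw => crossForm_nonneg_of_mem_closure hR.nocross hz hw
  fwd := forall_mem_closure_of_continuous
    ((continuous_s3.comp continuous_fst).prodMk (continuous_s3.comp continuous_snd)) hR.fwd
  anti := forall_mem_closure_of_continuous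
    ((continuous_antip.comp continuous_fst).prodMk (continuous_antip.comp continuous_snd)) hR.anti
  swap := forall_mem_closure_of_continuous (continuous_snd.prodMk continuous_fst) hR.swap

lemma IsGood.pullback {m t : ℝ} (h0 : 0 < t) (h1 : t < 1 / 6) {R : Set (S1 × S1)}
    (hR : IsGood m t R) : IsGood m t {z | z ∈ compat m t ∧ (s3 z.1, s3 z.2) ∈ R} where
  sub := fun _ hz => hz.1
  nocross := fun z hz w hw => not_lt.1 fun h =>
    not_lt.2 (hR.nocross _ hz.2 _ hw.2) (crossForm_s3_neg h0 h1 hz.1 hw.1 h)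
  fwd := fun z hz => ⟨hR.sub hz.2, hR.fwd _ hz.2⟩
  anti := fun z hz => ⟨antip_mem_compat hz.1, by
    change (s3 (antip z.1), s3 (antip z.2)) ∈ R
    rw [s3_antip, s3_antip]
    exact hR.anti _ hz.2⟩
  swap := fun z hz => ⟨swap_mem_compat hz.1, hR.swap _ hz.2⟩

lemma IsGood.sUnion {m t : ℝ} {C : Set (Set (S1 × S1))} (hC : IsChain (· ⊆ ·) C)
    (h : ∀ R ∈ C, IsGood m t R) : IsGood m t (⋃₀ C) where
  sub := sUnion_subset fun R hR => (h R hR).sub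
  nocross := by
    rintro z ⟨R, hR, hz⟩ w ⟨R', hR', hw⟩
    rcases hC.total hR hR' with hle | hle
    · exact (h R' hR').nocross z (hle hz) w hw
    · exact (h R hR).nocross z hz w (hle hw)
  fwd := by
    rintro z ⟨R, hR, hz⟩
    exact ⟨R, hR, (h R hR).fwd z hz⟩
  anti := by
    rintro z ⟨R, hR, hz⟩
    exact ⟨R, hR, (h R hR).anti z hz⟩
  swap := by
    rintro z ⟨R, hR, hz⟩
    exact ⟨R, hR, (h R hR).swap z hz⟩

/-- A closed good family containing the chord `{m - t/2, m + t/2}` and all compatible pairs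
which `s3` maps into the family. -/
structure IsSaturated (m t : ℝ) (R : Set (S1 × S1)) : Prop extends IsGood m t R where
  closed : IsClosed R
  pull : ∀ z ∈ compat m t, (s3 z.1, s3 z.2) ∈ R → z ∈ R
  base : (((m + -(t / 2) : ℝ) : S1), ((m + t / 2 : ℝ) : S1)) ∈ R

lemma IsGood.exists_isSaturated {m t : ℝ} (h0 : 0 < t) (h1 : t < 1 / 6) {A : Set (S1 × S1)}
    (hA : IsGood m t A) (hc : (((m + -(t / 2) : ℝ) : S1), ((m + t / 2 : ℝ) : S1)) ∈ A) :
    ∃ R, IsSaturated m t R := by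
  obtain ⟨R, hAR, hR⟩ := zorn_subset_nonempty {R | IsGood m t R}
    (fun C hC hchain _ => ⟨⋃₀ C, IsGood.sUnion hchain hC, fun s hs => subset_sUnion_of_mem hs⟩) A hA
  have hgood : IsGood m t R := hR.prop
  refine ⟨R, { hgood with closed := ?_, pull := ?_, base := hAR hc }⟩
  · exact closure_subset_iff_isClosed.1 (hR.2 hgood.closure subset_closure)
  · intro z hz hz'
    exact hR.2 (hgood.pullback h0 h1) (fun w hw => ⟨hgood.sub hw, hgood.fwd w hw⟩) ⟨hz, hz'⟩

lemma cmap_iterate_antip (i : ℕ) (ℓ : Chord) :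
    cmap s3^[i] (cmap antip ℓ) = cmap antip (cmap s3^[i] ℓ) := by
  induction ℓ using Sym2.ind with
  | _ x y => simp only [cmap_mk, s3_iterate_antip]

/-- The ordered pairs of endpoints of the orbits of `c` and its antipode. -/
def orbitPairs (c : Chord) : Set (S1 × S1) :=
  {z | ∃ i : ℕ, s(z.1, z.2) = cmap s3^[i] c ∨ s(z.1, z.2) = cmap s3^[i] (cmap antip c)}

lemma isGood_orbitPairs {a t : ℝ} {c : Chord} (h0 : 0 < t) (h1 : t < 1 / 6)
    (hc : c = s((a : S1), ((a + t : ℝ) : S1)))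
    (hcross : ∀ i j : ℕ,
      ¬ Crosses (cmap (s3^[i]) c) (cmap (s3^[j]) c) ∧
      ¬ Crosses (cmap (s3^[i]) c) (cmap (s3^[j]) (cmap antip c)) ∧
      ¬ Crosses (cmap (s3^[i]) (cmap antip c)) (cmap (s3^[j]) (cmap antip c)))
    (hstrip : ∀ i : ℕ, 1 ≤ i →
      chordSet (cmap (s3^[i]) c) ∩ interior (QStrip a t ∪ QStrip (a + 1 / 2) t) = ∅) :
    IsGood (a + t / 2) t (orbitPairs c) := by
  have hsub : ∀ (i : ℕ) (x y : S1), s(x, y) = cmap s3^[i] c → (x, y) ∈ compat (a + t / 2) t := by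
    intro i x y h
    rcases Nat.eq_zero_or_pos i with rfl | hi
    · have key : ((a : S1), ((a + t : ℝ) : S1)) ∈ compat (a + t / 2) t := by
        refine mem_compat_of_arc (I := (-(1 / 6 - t / 2), 1 / 6 - t / 2)) (by simp [arcBounds])
          ?_ ?_
        · exact mem_arc_of_eq (θ := -(t / 2)) 0 (by push_cast; ring) (by linarith) (by linarith)
        · exact mem_arc_of_eq (θ := t / 2) 0 (by push_cast; ring) (by linarith) (by linarith)
      rw [cmap_iterate_zero, hc] at h
      rcases Sym2.eq_iff.1 h with ⟨rfl, rfl⟩ | ⟨rfl, rfl⟩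
      · exact key
      · exact swap_mem_compat key
    · have := hstrip i hi
      rw [← h] at this
      exact mem_compat_of_inter_interior h0 h1 this
  refine ⟨?_, ?_, ?_, ?_, ?_⟩
  · rintro ⟨x, y⟩ ⟨i, h | h⟩
    · exact hsub i x y h
    · have h' : s(antip x, antip y) = cmap s3^[i] c := by
        rw [cmap_iterate_antip] at h
        rw [← cmap_antip_antip (cmap s3^[i] c), ← h, cmap_mk]
      have := antip_mem_compat (hsub i _ _ h')
      rwa [antip_antip, antip_antip] at this
  · rintro ⟨x, y⟩ ⟨i, h⟩ ⟨u, v⟩ ⟨j, h'⟩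
    rcases h with h | h <;> rcases h' with h' | h'
    · rw [← not_crosses_iff, h, h']
      exact (hcross i j).1
    · rw [← not_crosses_iff, h, h']
      exact (hcross i j).2.1
    · rw [← crossForm_comm, ← not_crosses_iff, h, h']
      exact (hcross j i).2.1
    · rw [← not_crosses_iff, h, h']
      exact (hcross i j).2.2
  · rintro ⟨x, y⟩ ⟨i, h⟩
    refine ⟨i + 1, ?_⟩
    rw [cmap_iterate_succ, cmap_iterate_succ]
    exact h.imp (fun h => by rw [← h, cmap_mk]) (fun h => by rw [← h, cmap_mk])
  · rintro ⟨x, y⟩ ⟨i, h⟩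
    refine ⟨i, ?_⟩
    rw [cmap_iterate_antip] at h ⊢
    refine h.symm.imp (fun h => ?_) (fun h => by rw [← h, cmap_mk])
    rw [← cmap_antip_antip (cmap s3^[i] c), ← h, cmap_mk]
  · rintro ⟨x, y⟩ ⟨i, h⟩
    refine ⟨i, ?_⟩
    rwa [Sym2.eq_swap]

/-! ### Properties of saturated families -/

lemma s3_eq_of_eq {x y : ℝ} (n : ℤ) (h : 3 * x = 3 * y + n) : s3 (x : S1) = s3 (y : S1) := by
  rw [s3_coe, s3_coe]
  exact coe_eq_coe n h

/-- The pair `(x, y)` has two siblings in `R` such that the three chords are pairwise disjoint. -/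
def HasSiblings (R : Set (S1 × S1)) (x y : S1) : Prop :=
  ∃ x₂ y₂ x₃ y₃ : S1, (x₂, y₂) ∈ R ∧ (x₃, y₃) ∈ R ∧ s3 x₂ = s3 x ∧ s3 y₂ = s3 y ∧
    s3 x₃ = s3 x ∧ s3 y₃ = s3 y ∧ 0 < crossForm x y x₂ y₂ ∧ 0 < crossForm x y x₃ y₃ ∧
    0 < crossForm x₂ y₂ x₃ y₃

lemma IsGood.hasSiblings_swap {m t : ℝ} {R : Set (S1 × S1)} (hR : IsGood m t R) {x y : S1}
    (h : HasSiblings R x y) : HasSiblings R y x := by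
  obtain ⟨x₂, y₂, x₃, y₃, h2, h3, e1, e2, e3, e4, c1, c2, c3⟩ := h
  refine ⟨y₂, x₂, y₃, x₃, hR.swap _ h2, hR.swap _ h3, e2, e1, e4, e3, ?_, ?_, ?_⟩ <;>
    rwa [crossForm_swap_left, crossForm_swap_right]

lemma IsGood.hasSiblings_antip {m t : ℝ} {R : Set (S1 × S1)} (hR : IsGood m t R) {x y : S1}
    (h : HasSiblings R (antip x) (antip y)) : HasSiblings R x y := by
  obtain ⟨x₂, y₂, x₃, y₃, h2, h3, e1, e2, e3, e4, c1, c2, c3⟩ := h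
  have key : ∀ {u v : S1}, s3 u = s3 (antip v) → s3 (antip u) = s3 v := by
    intro u v h
    rw [s3_antip, h, s3_antip, antip_antip]
  refine ⟨_, _, _, _, hR.anti _ h2, hR.anti _ h3, key e1, key e2, key e3, key e4, ?_, ?_, ?_⟩
  · rwa [← crossForm_antip, antip_antip, antip_antip]
  · rwa [← crossForm_antip, antip_antip, antip_antip]
  · rwa [crossForm_antip]

namespace IsSaturated

variable {m t : ℝ} {R : Set (S1 × S1)}

lemma hasSiblings_of_compat (hR : IsSaturated m t R) {x y x₂ y₂ x₃ y₃ : S1} (h : (x, y) ∈ R)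
    (h2 : (x₂, y₂) ∈ compat m t) (h3 : (x₃, y₃) ∈ compat m t) (e1 : s3 x₂ = s3 x)
    (e2 : s3 y₂ = s3 y) (e3 : s3 x₃ = s3 x) (e4 : s3 y₃ = s3 y) (c1 : 0 < crossForm x y x₂ y₂)
    (c2 : 0 < crossForm x y x₃ y₃) (c3 : 0 < crossForm x₂ y₂ x₃ y₃) : HasSiblings R x y := by
  have hf : (s3 x, s3 y) ∈ R := hR.fwd _ h
  refine ⟨x₂, y₂, x₃, y₃, hR.pull _ h2 ?_, hR.pull _ h3 ?_, e1, e2, e3, e4, c1, c2, c3⟩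
  · dsimp only
    rwa [e1, e2]
  · dsimp only
    rwa [e3, e4]

/-- Siblings obtained by rotating a short chord. -/
lemma hasSiblings_of_rotate (hR : IsSaturated m t R) {θ φ : ℝ} (h1 : θ - φ < 1 / 3)
    (h2 : φ - θ < 1 / 3) (h : (((m + θ : ℝ) : S1), ((m + φ : ℝ) : S1)) ∈ R)
    (hc : (((m + (θ + 1 / 3) : ℝ) : S1), ((m + (φ + 1 / 3) : ℝ) : S1)) ∈ compat m t)
    (hc' : (((m + (θ + 2 / 3) : ℝ) : S1), ((m + (φ + 2 / 3) : ℝ) : S1)) ∈ compat m t) :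
    HasSiblings R ((m + θ : ℝ) : S1) ((m + φ : ℝ) : S1) := by
  refine hR.hasSiblings_of_compat h hc hc' ?_ ?_ ?_ ?_ ?_ ?_ ?_
  · exact s3_eq_of_eq 1 (by push_cast; ring)
  · exact s3_eq_of_eq 1 (by push_cast; ring)
  · exact s3_eq_of_eq 2 (by push_cast; ring)
  · exact s3_eq_of_eq 2 (by push_cast; ring)
  all_goals apply crossForm_pos_of_lt <;> linarith

/-- Siblings of a chord over `{m - t/2, m + t/2}`, and their siblings. -/
lemma hasSiblings_of_nested (hR : IsSaturated m t R) (h0 : 0 < t) {θ φ : ℝ}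
    (h1 : -(1 / 6 - t / 2) ≤ θ) (h2 : θ ≤ -(t / 2)) (h3 : t / 2 ≤ φ) (h4 : φ ≤ 1 / 6 - t / 2) :
    ((((m + θ : ℝ) : S1), ((m + φ : ℝ) : S1)) ∈ R →
      HasSiblings R ((m + θ : ℝ) : S1) ((m + φ : ℝ) : S1)) ∧
    ((((m + (θ + 1 / 3) : ℝ) : S1), ((m + (φ + 2 / 3) : ℝ) : S1)) ∈ R →
      HasSiblings R ((m + (θ + 1 / 3) : ℝ) : S1) ((m + (φ + 2 / 3) : ℝ) : S1)) := by
  have c1 : (((m + θ : ℝ) : S1), ((m + φ : ℝ) : S1)) ∈ compat m t :=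
    mem_compat_of_arc (I := (-(1 / 6 - t / 2), 1 / 6 - t / 2)) (by simp [arcBounds])
      (mem_arc (by linarith) (by linarith)) (mem_arc (by linarith) (by linarith))
  have c2 : (((m + (θ + 1 / 3) : ℝ) : S1), ((m + (φ + 2 / 3) : ℝ) : S1)) ∈ compat m t :=
    Or.inr ⟨Or.inl (mem_arc (by linarith) (by linarith)),
      Or.inr (mem_arc (by linarith) (by linarith))⟩
  have c3 : (((m + (θ + 2 / 3) : ℝ) : S1), ((m + (φ + 1 / 3) : ℝ) : S1)) ∈ compat m t :=
    mem_compat_of_arc (I := (1 / 3 + t / 2, 2 / 3 - t / 2)) (by simp [arcBounds])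
      (mem_arc (by linarith) (by linarith)) (mem_arc (by linarith) (by linarith))
  have p12 : 0 < crossForm ((m + θ : ℝ) : S1) ((m + φ : ℝ) : S1) ((m + (θ + 1 / 3) : ℝ) : S1)
      ((m + (φ + 2 / 3) : ℝ) : S1) := by
    apply crossForm_pos_of_lt <;> linarith
  have p13 : 0 < crossForm ((m + θ : ℝ) : S1) ((m + φ : ℝ) : S1) ((m + (θ + 2 / 3) : ℝ) : S1)
      ((m + (φ + 1 / 3) : ℝ) : S1) := by
    apply crossForm_pos_of_lt <;> linarith
  have p23 : 0 < crossForm ((m + (θ + 1 / 3) : ℝ) : S1) ((m + (φ + 2 / 3) : ℝ) : S1)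
      ((m + (θ + 2 / 3) : ℝ) : S1) ((m + (φ + 1 / 3) : ℝ) : S1) := by
    rw [coe_eq_coe (x := m + (φ + 2 / 3)) (y := m + (φ - 1 / 3)) 1 (by push_cast; ring)]
    apply crossForm_pos_of_lt <;> linarith
  have e1 : s3 ((m + (θ + 1 / 3) : ℝ) : S1) = s3 ((m + θ : ℝ) : S1) :=
    s3_eq_of_eq 1 (by push_cast; ring)
  have e2 : s3 ((m + (θ + 2 / 3) : ℝ) : S1) = s3 ((m + θ : ℝ) : S1) :=
    s3_eq_of_eq 2 (by push_cast; ring)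
  have e3 : s3 ((m + (φ + 1 / 3) : ℝ) : S1) = s3 ((m + φ : ℝ) : S1) :=
    s3_eq_of_eq 1 (by push_cast; ring)
  have e4 : s3 ((m + (φ + 2 / 3) : ℝ) : S1) = s3 ((m + φ : ℝ) : S1) :=
    s3_eq_of_eq 2 (by push_cast; ring)
  refine ⟨fun h => hR.hasSiblings_of_compat h c2 c3 e1 e4 e2 e3 p12 p13 p23, fun h =>
    hR.hasSiblings_of_compat h c1 c3 e1.symm e4.symm (e2.trans e1.symm) (e3.trans e4.symm) ?_
      p23 p13⟩
  rwa [crossForm_comm]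

lemma hasSiblings_of_mem_central_of_le (hR : IsSaturated m t R) (h0 : 0 < t) (h1 : t < 1 / 6)
    {θ φ : ℝ} (h2 : -(1 / 6 - t / 2) ≤ θ) (hle : θ ≤ φ) (h5 : φ ≤ 1 / 6 - t / 2)
    (h : (((m + θ : ℝ) : S1), ((m + φ : ℝ) : S1)) ∈ R) :
    HasSiblings R ((m + θ : ℝ) : S1) ((m + φ : ℝ) : S1) := by
  have hbase := hR.nocross _ hR.base _ h
  dsimp only at hbase
  rcases le_or_gt φ (-(t / 2)) with h6 | h6
  · apply hR.hasSiblings_of_rotate (by linarith) (by linarith) h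
    · exact Or.inr ⟨Or.inl (mem_arc (by linarith) (by linarith)),
        Or.inl (mem_arc (by linarith) (by linarith))⟩
    · exact mem_compat_of_arc (I := (1 / 3 + t / 2, 2 / 3 - t / 2)) (by simp [arcBounds])
        (mem_arc (by linarith) (by linarith)) (mem_arc (by linarith) (by linarith))
  rcases le_or_gt (t / 2) θ with h7 | h7
  · apply hR.hasSiblings_of_rotate (by linarith) (by linarith) h
    · exact mem_compat_of_arc (I := (1 / 3 + t / 2, 2 / 3 - t / 2)) (by simp [arcBounds])
        (mem_arc (by linarith) (by linarith)) (mem_arc (by linarith) (by linarith))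
    · exact Or.inr ⟨Or.inr (mem_arc (by linarith) (by linarith)),
        Or.inr (mem_arc (by linarith) (by linarith))⟩
  rcases le_or_gt (-(t / 2)) θ with h8 | h8
  · rcases le_or_gt φ (t / 2) with h9 | h9
    · apply hR.hasSiblings_of_rotate (by linarith) (by linarith) h
      · exact mem_compat_of_arc (I := (1 / 3 - t / 2, 1 / 3 + t / 2)) (by simp [arcBounds])
          (mem_arc (by linarith) (by linarith)) (mem_arc (by linarith) (by linarith))
      · exact mem_compat_of_arc (I := (2 / 3 - t / 2, 2 / 3 + t / 2)) (by simp [arcBounds])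
          (mem_arc (by linarith) (by linarith)) (mem_arc (by linarith) (by linarith))
    · rcases h8.eq_or_lt with rfl | h8
      · exact (hR.hasSiblings_of_nested h0 h2 le_rfl h9.le h5).1 h
      · refine absurd hbase (not_le.2 ?_)
        apply crossForm_neg_of_alternate <;> linarith
  · rcases le_or_gt (t / 2) φ with h9 | h9
    · exact (hR.hasSiblings_of_nested h0 h2 h8.le h9 h5).1 h
    · refine absurd hbase (not_le.2 ?_)
      rw [crossForm_comm]
      apply crossForm_neg_of_alternate <;> linarith

lemma hasSiblings_of_mem_central (hR : IsSaturated m t R) (h0 : 0 < t) (h1 : t < 1 / 6) {θ φ : ℝ}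
    (hθ : θ ∈ Icc (-(1 / 6 - t / 2)) (1 / 6 - t / 2))
    (hφ : φ ∈ Icc (-(1 / 6 - t / 2)) (1 / 6 - t / 2))
    (h : (((m + θ : ℝ) : S1), ((m + φ : ℝ) : S1)) ∈ R) :
    HasSiblings R ((m + θ : ℝ) : S1) ((m + φ : ℝ) : S1) := by
  rcases le_total θ φ with hle | hle
  · exact hR.hasSiblings_of_mem_central_of_le h0 h1 hθ.1 hle hφ.2 h
  · exact hR.hasSiblings_swap
      (hR.hasSiblings_of_mem_central_of_le h0 h1 hφ.1 hle hθ.2 (hR.swap _ h))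

/-- Every pair in a saturated family has siblings. -/
lemma hasSiblings (hR : IsSaturated m t R) (h0 : 0 < t) (h1 : t < 1 / 6) {x y : S1}
    (h : (x, y) ∈ R) : HasSiblings R x y := by
  have opp : ∀ {θ φ : ℝ}, (((m + θ : ℝ) : S1), ((m + φ : ℝ) : S1)) ∈ R →
      ((((m + (θ - 1 / 2) : ℝ) : S1), ((m + (φ - 1 / 2) : ℝ) : S1)) ∈ R →
        HasSiblings R ((m + (θ - 1 / 2) : ℝ) : S1) ((m + (φ - 1 / 2) : ℝ) : S1)) →
      HasSiblings R ((m + θ : ℝ) : S1) ((m + φ : ℝ) : S1) := by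
    intro θ φ h hs
    have e : ∀ θ : ℝ, antip ((m + θ : ℝ) : S1) = ((m + (θ - 1 / 2) : ℝ) : S1) := fun θ => by
      rw [antip_coe]
      exact coe_eq_coe 1 (by push_cast; ring)
    have h' := hR.anti _ h
    dsimp only at h'
    rw [e, e] at h'
    apply hR.hasSiblings_antip
    rw [e, e]
    exact hs h'
  have q1 : ∀ {θ φ : ℝ}, θ ∈ Icc (1 / 6 - t / 2) (1 / 6 + t / 2) →
      φ ∈ Icc (1 / 6 - t / 2) (1 / 6 + t / 2) →
      (((m + θ : ℝ) : S1), ((m + φ : ℝ) : S1)) ∈ R →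
      HasSiblings R ((m + θ : ℝ) : S1) ((m + φ : ℝ) : S1) := by
    rintro θ φ ⟨h2, h3⟩ ⟨h4, h5⟩ h
    apply hR.hasSiblings_of_rotate (by linarith) (by linarith) h
    · exact mem_compat_of_arc (I := (1 / 3 + t / 2, 2 / 3 - t / 2)) (by simp [arcBounds])
        (mem_arc (by linarith) (by linarith)) (mem_arc (by linarith) (by linarith))
    · exact mem_compat_of_arc (I := (5 / 6 - t / 2, 5 / 6 + t / 2)) (by simp [arcBounds])
        (mem_arc (by linarith) (by linarith)) (mem_arc (by linarith) (by linarith))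
  have q2 : ∀ {θ φ : ℝ}, θ ∈ Icc (1 / 3 - t / 2) (1 / 3 + t / 2) →
      φ ∈ Icc (1 / 3 - t / 2) (1 / 3 + t / 2) →
      (((m + θ : ℝ) : S1), ((m + φ : ℝ) : S1)) ∈ R →
      HasSiblings R ((m + θ : ℝ) : S1) ((m + φ : ℝ) : S1) := by
    rintro θ φ ⟨h2, h3⟩ ⟨h4, h5⟩ h
    apply hR.hasSiblings_of_rotate (by linarith) (by linarith) h
    · exact mem_compat_of_arc (I := (2 / 3 - t / 2, 2 / 3 + t / 2)) (by simp [arcBounds])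
        (mem_arc (by linarith) (by linarith)) (mem_arc (by linarith) (by linarith))
    · exact mem_compat_of_arc (I := (-(1 / 6 - t / 2), 1 / 6 - t / 2)) (by simp [arcBounds])
        (mem_arc_of_eq (θ := θ - 1 / 3) 1 (by push_cast; ring) (by linarith) (by linarith))
        (mem_arc_of_eq (θ := φ - 1 / 3) 1 (by push_cast; ring) (by linarith) (by linarith))
  have mid : ∀ {θ φ : ℝ}, θ ∈ Icc (1 / 6 + t / 2) (1 / 3 - t / 2) →
      φ ∈ Icc (1 / 6 + t / 2) (1 / 3 - t / 2) →
      (((m + θ : ℝ) : S1), ((m + φ : ℝ) : S1)) ∈ R →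
      HasSiblings R ((m + θ : ℝ) : S1) ((m + φ : ℝ) : S1) := by
    rintro θ φ ⟨h2, h3⟩ ⟨h4, h5⟩ h
    apply hR.hasSiblings_of_rotate (by linarith) (by linarith) h
    · exact mem_compat_of_arc (I := (1 / 3 + t / 2, 2 / 3 - t / 2)) (by simp [arcBounds])
        (mem_arc (by linarith) (by linarith)) (mem_arc (by linarith) (by linarith))
    · exact mem_compat_of_arc (I := (-(1 / 6 - t / 2), 1 / 6 - t / 2)) (by simp [arcBounds])
        (mem_arc_of_eq (θ := θ - 1 / 3) 1 (by push_cast; ring) (by linarith) (by linarith))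
        (mem_arc_of_eq (θ := φ - 1 / 3) 1 (by push_cast; ring) (by linarith) (by linarith))
  have mix : ∀ {θ φ : ℝ}, θ ∈ Icc (1 / 6 + t / 2) (1 / 3 - t / 2) →
      φ ∈ Icc (2 / 3 + t / 2) (5 / 6 - t / 2) →
      (((m + θ : ℝ) : S1), ((m + φ : ℝ) : S1)) ∈ R →
      HasSiblings R ((m + θ : ℝ) : S1) ((m + φ : ℝ) : S1) := by
    rintro θ φ ⟨h2, h3⟩ ⟨h4, h5⟩
    have := (hR.hasSiblings_of_nested h0 (θ := θ - 1 / 3) (φ := φ - 2 / 3) (by linarith)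
      (by linarith) (by linarith) (by linarith)).2
    rwa [sub_add_cancel, sub_add_cancel] at this
  rcases compat_cases (hR.sub h) with ⟨I, hI, ⟨θ, hθ, rfl⟩, ⟨φ, hφ, rfl⟩⟩ |
    ⟨⟨θ, hθ, rfl⟩ | ⟨θ, hθ, rfl⟩, ⟨φ, hφ, rfl⟩ | ⟨φ, hφ, rfl⟩⟩
  · have sh : ∀ {p q p' q' θ : ℝ}, θ ∈ Icc p q → p = p' + 1 / 2 → q = q' + 1 / 2 →
        θ - 1 / 2 ∈ Icc p' q' := fun hθ e1 e2 => ⟨by linarith [hθ.1], by linarith [hθ.2]⟩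
    rcases hI with rfl | rfl | rfl | rfl | rfl | rfl
    · exact hR.hasSiblings_of_mem_central h0 h1 hθ hφ h
    · exact q1 hθ hφ h
    · exact q2 hθ hφ h
    · exact opp h (hR.hasSiblings_of_mem_central h0 h1 (sh hθ (by ring) (by ring))
        (sh hφ (by ring) (by ring)))
    · exact opp h (q1 (sh hθ (by ring) (by ring)) (sh hφ (by ring) (by ring)))
    · exact opp h (q2 (sh hθ (by ring) (by ring)) (sh hφ (by ring) (by ring)))
  · exact mid hθ hφ h
  · exact mix hθ hφ h
  · exact hR.hasSiblings_swap (mix hφ hθ (hR.swap _ h))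
  · exact opp h (mid ⟨by linarith [hθ.1], by linarith [hθ.2]⟩
      ⟨by linarith [hφ.1], by linarith [hφ.2]⟩)

/-- Every pair in a saturated family has a preimage in the family. -/
lemma exists_preimage (hR : IsSaturated m t R) (h0 : 0 < t) {u v : S1} (h : (u, v) ∈ R) :
    ∃ z ∈ R, s3 z.1 = u ∧ s3 z.2 = v := by
  obtain ⟨η, h2, h3, rfl⟩ := exists_lift (3 * m) (-(1 / 2) + 3 * t / 2) u
  obtain ⟨ζ, h4, h5, rfl⟩ := exists_lift (3 * m) (-(1 / 2) + 3 * t / 2) v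
  wlog hle : η ≤ ζ generalizing η ζ
  · obtain ⟨z, hz, e1, e2⟩ := this ζ h4 h5 η h2 h3 (hR.swap _ h) (le_of_not_ge hle)
    exact ⟨(z.2, z.1), hR.swap _ hz, e2, e1⟩
  have hs : ∀ {θ η : ℝ} (n : ℤ), 3 * θ = η + n →
      s3 ((m + θ : ℝ) : S1) = ((3 * m + η : ℝ) : S1) := by
    intro θ η n h
    rw [s3_coe]
    exact coe_eq_coe n (by linarith)
  have key : ∀ {I : ℝ × ℝ} {θ φ : ℝ} (n : ℤ), I ∈ arcBounds t → θ ∈ Icc I.1 I.2 →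
      φ ∈ Icc I.1 I.2 → 3 * θ = η + n → 3 * φ = ζ →
      ∃ z ∈ R, s3 z.1 = ((3 * m + η : ℝ) : S1) ∧ s3 z.2 = ((3 * m + ζ : ℝ) : S1) := by
    intro I θ φ n hI hθ hφ e1 e2
    have e1 := hs n e1
    have e2 := hs (θ := φ) (η := ζ) 0 (by push_cast; linarith)
    refine ⟨(((m + θ : ℝ) : S1), ((m + φ : ℝ) : S1)), hR.pull _
      (mem_compat_of_arc hI (mem_arc hθ.1 hθ.2) (mem_arc hφ.1 hφ.2)) ?_, e1, e2⟩
    dsimp only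
    rwa [e1, e2]
  rcases le_or_gt ζ (1 / 2 - 3 * t / 2) with h6 | h6
  · exact key (I := (-(1 / 6 - t / 2), 1 / 6 - t / 2)) (θ := η / 3) (φ := ζ / 3) 0
      (by simp [arcBounds]) ⟨by dsimp only; linarith, by dsimp only; linarith⟩
      ⟨by dsimp only; linarith, by dsimp only; linarith⟩ (by push_cast; ring) (by ring)
  rcases le_or_gt (1 / 2 - 3 * t / 2) η with h7 | h7
  · exact key (I := (1 / 6 - t / 2, 1 / 6 + t / 2)) (θ := η / 3) (φ := ζ / 3) 0
      (by simp [arcBounds]) ⟨by dsimp only; linarith, by dsimp only; linarith⟩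
      ⟨by dsimp only; linarith, by dsimp only; linarith⟩ (by push_cast; ring) (by ring)
  rcases h2.eq_or_lt with h8 | h8
  · exact key (I := (1 / 6 - t / 2, 1 / 6 + t / 2)) (θ := (η + 1) / 3) (φ := ζ / 3) 1
      (by simp [arcBounds]) ⟨by dsimp only; linarith, by dsimp only; linarith⟩
      ⟨by dsimp only; linarith, by dsimp only; linarith⟩ (by push_cast; ring) (by ring)
  · have hb := hR.fwd _ (hR.anti _ hR.base)
    have e1 : s3 (antip ((m + -(t / 2) : ℝ) : S1)) =
        ((3 * m + (1 / 2 - 3 * t / 2) : ℝ) : S1) := by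
      rw [antip_coe, s3_coe]
      exact coe_eq_coe 1 (by push_cast; ring)
    have e2 : s3 (antip ((m + t / 2 : ℝ) : S1)) = ((3 * m + (1 / 2 + 3 * t / 2) : ℝ) : S1) := by
      rw [antip_coe, s3_coe]
      exact coe_eq_coe 1 (by push_cast; ring)
    dsimp only at hb
    rw [e1, e2] at hb
    refine absurd (hR.nocross _ h _ hb) (not_le.2 ?_)
    apply crossForm_neg_of_alternate <;> linarith

end IsSaturated

lemma le_abs_sub_norm_of_mem_compat {m t : ℝ} (h0 : 0 < t) (h1 : t < 1 / 6) {x y : S1}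
    (h : (x, y) ∈ compat m t) : t ≤ |1 / 3 - ‖x - y‖| ∧ (|1 / 3 - ‖x - y‖| ≤ t →
      ∃ θ ∈ Icc (1 / 6 - t / 2) (1 - (1 / 6 - t / 2)),
        ∃ φ ∈ Icc (1 / 6 - t / 2) (1 - (1 / 6 - t / 2)),
          x = ((m + θ : ℝ) : S1) ∧ y = ((m + φ : ℝ) : S1)) := by
  have hd : ∀ θ φ : ℝ, ((m + θ : ℝ) : S1) - ((m + φ : ℝ) : S1) = ((θ - φ : ℝ) : S1) := by
    intro θ φ
    rw [← AddCircle.coe_sub]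
    congr 1
    ring
  have short : ∀ θ φ : ℝ, |θ - φ| ≤ 1 / 3 - t →
      ‖((m + θ : ℝ) : S1) - ((m + φ : ℝ) : S1)‖ = |θ - φ| := by
    intro θ φ h
    rw [hd, norm_coe_of_abs_le (by linarith)]
  have long : ∀ θ φ : ℝ, θ ∈ Icc (1 / 6 + t / 2) (1 / 3 - t / 2) →
      φ ∈ Icc (2 / 3 + t / 2) (5 / 6 - t / 2) →
      1 / 3 + t ≤ ‖((m + φ : ℝ) : S1) - ((m + θ : ℝ) : S1)‖ := by
    rintro θ φ ⟨h2, h3⟩ ⟨h4, h5⟩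
    rw [hd]
    rcases le_total (φ - θ) (1 / 2) with h | h
    · rw [norm_coe_of_nonneg (by linarith) h]
      linarith
    · rw [norm_coe_of_half_le h (by linarith)]
      linarith
  rcases compat_cases h with ⟨I, hI, ⟨θ, hθ, rfl⟩, ⟨φ, hφ, rfl⟩⟩ |
    ⟨⟨θ, hθ, rfl⟩ | ⟨θ, hθ, rfl⟩, ⟨φ, hφ, rfl⟩ | ⟨φ, hφ, rfl⟩⟩
  · have hw : |θ - φ| ≤ 1 / 3 - t := by
      obtain ⟨h2, h3⟩ := hθ
      obtain ⟨h4, h5⟩ := hφ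
      rw [abs_le]
      rcases hI with rfl | rfl | rfl | rfl | rfl | rfl <;> dsimp only at h2 h3 h4 h5 <;>
        constructor <;> linarith
    dsimp only
    rw [short _ _ hw]
    refine ⟨le_abs.2 (Or.inl (by linarith)), fun hle => ?_⟩
    have hle := (abs_le.1 hle).2
    obtain ⟨h2, h3⟩ := hθ
    obtain ⟨h4, h5⟩ := hφ
    rcases hI with rfl | hI
    · dsimp only at h2 h3 h4 h5
      have e : ((m + -(1 / 6 - t / 2) : ℝ) : S1) = ((m + (1 - (1 / 6 - t / 2)) : ℝ) : S1) :=
        coe_eq_coe (-1) (by push_cast; ring)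
      rcases abs_cases (θ - φ) with ⟨ha, -⟩ | ⟨ha, -⟩
      · obtain rfl : θ = 1 / 6 - t / 2 := by linarith
        obtain rfl : φ = -(1 / 6 - t / 2) := by linarith
        exact ⟨1 / 6 - t / 2, ⟨le_rfl, by linarith⟩, 1 - (1 / 6 - t / 2),
          ⟨by linarith, le_rfl⟩, rfl, e⟩
      · obtain rfl : φ = 1 / 6 - t / 2 := by linarith
        obtain rfl : θ = -(1 / 6 - t / 2) := by linarith
        exact ⟨1 - (1 / 6 - t / 2), ⟨by linarith, le_rfl⟩, 1 / 6 - t / 2,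
          ⟨le_rfl, by linarith⟩, e, rfl⟩
    · have hsub : 1 / 6 - t / 2 ≤ I.1 ∧ I.2 ≤ 1 - (1 / 6 - t / 2) := by
        rcases hI with rfl | rfl | rfl | rfl | rfl <;> dsimp only <;> constructor <;> linarith
      exact ⟨θ, ⟨by linarith, by linarith⟩, φ, ⟨by linarith, by linarith⟩, rfl, rfl⟩
  all_goals
    obtain ⟨h2, h3⟩ := hθ
    obtain ⟨h4, h5⟩ := hφ
    refine ⟨?_, fun _ => ⟨θ, ⟨by linarith, by linarith⟩, φ, ⟨by linarith, by linarith⟩,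
      rfl, rfl⟩⟩
  · have hw : |θ - φ| ≤ 1 / 3 - t := abs_le.2 ⟨by linarith, by linarith⟩
    dsimp only
    rw [short _ _ hw]
    exact le_abs.2 (Or.inl (by linarith))
  · have := long θ φ ⟨h2, h3⟩ ⟨h4, h5⟩
    rw [norm_sub_rev] at this
    exact le_abs.2 (Or.inr (by linarith))
  · have := long φ θ ⟨h4, h5⟩ ⟨h2, h3⟩
    exact le_abs.2 (Or.inr (by linarith))
  · have hw : |θ - φ| ≤ 1 / 3 - t := abs_le.2 ⟨by linarith, by linarith⟩
    dsimp only
    rw [short _ _ hw]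
    exact le_abs.2 (Or.inl (by linarith))

/-- The chords spanned by a family of pairs. -/
def chordsOf (R : Set (S1 × S1)) : Set Chord := {ℓ | ∃ z ∈ R, s(z.1, z.2) = ℓ}

lemma isClosed_unionSet_chordsOf {R : Set (S1 × S1)} (hR : IsClosed R) :
    IsClosed (unionSet (chordsOf R)) := by
  have hcont : Continuous fun p : (S1 × S1) × ℝ =>
      (1 - p.2) • toC p.1.1 + p.2 • toC p.1.2 :=
    ((continuous_const.sub continuous_snd).smul
      (continuous_toC.comp (continuous_fst.comp continuous_fst))).add
      (continuous_snd.smul (continuous_toC.comp (continuous_snd.comp continuous_fst)))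
  have hU : unionSet (chordsOf R) =
      (fun p : (S1 × S1) × ℝ => (1 - p.2) • toC p.1.1 + p.2 • toC p.1.2) '' (R ×ˢ Icc 0 1) := by
    ext w
    constructor
    · intro hw
      obtain ⟨ℓ, ⟨z, hz, rfl⟩, hw⟩ := mem_iUnion₂.1 hw
      rw [chordSet_mk, segment_eq_image] at hw
      obtain ⟨r, hr, rfl⟩ := hw
      exact ⟨(z, r), ⟨hz, hr⟩, rfl⟩
    · rintro ⟨⟨z, r⟩, ⟨hz, hr⟩, rfl⟩
      refine mem_iUnion₂.2 ⟨s(z.1, z.2), ⟨z, hz, rfl⟩, ?_⟩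
      rw [chordSet_mk, segment_eq_image]
      exact ⟨r, hr, rfl⟩
  rw [hU]
  exact ((hR.isCompact.prod isCompact_Icc).image hcont).isClosed

namespace IsSaturated

variable {m t : ℝ} {R : Set (S1 × S1)}

lemma isCubicSymLam (hR : IsSaturated m t R) (h0 : 0 < t) (h1 : t < 1 / 6) :
    IsCubicSymLam (chordsOf R) where
  nocross := by
    rintro _ ⟨z, hz, rfl⟩ _ ⟨w, hw, rfl⟩
    exact (not_crosses_iff _ _ _ _).2 (hR.nocross z hz w hw)
  closed := isClosed_unionSet_chordsOf hR.closed
  forward := by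
    rintro _ ⟨z, hz, rfl⟩
    exact Or.inl ⟨_, hR.fwd z hz, rfl⟩
  backward := by
    rintro _ ⟨z, hz, rfl⟩
    obtain ⟨w, hw, e1, e2⟩ := hR.exists_preimage h0 hz
    exact ⟨_, ⟨w, hw, rfl⟩, by rw [cmap_mk, e1, e2]⟩
  siblings := by
    rintro _ ⟨z, hz, rfl⟩ hnd
    obtain ⟨x₂, y₂, x₃, y₃, h2, h3, e1, e2, e3, e4, c1, c2, c3⟩ := hR.hasSiblings h0 h1 hz
    exact ⟨_, ⟨_, h2, rfl⟩, _, ⟨_, h3, rfl⟩, disjoint_of_crossForm_pos c1,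
      disjoint_of_crossForm_pos c2, disjoint_of_crossForm_pos c3, hnd,
      by simp only [cmap_mk, e1, e2], by simp only [cmap_mk, e3, e4]⟩
  symm := by
    rintro _ ⟨z, hz, rfl⟩
    exact ⟨_, hR.anti z hz, rfl⟩

lemma isComajor (hR : IsSaturated m t R) (h0 : 0 < t) (h1 : t < 1 / 6) :
    IsComajor (chordsOf R) s(((m + -(t / 2) : ℝ) : S1), ((m + t / 2 : ℝ) : S1)) := by
  have e1 : s3 ((m + (-(t / 2) + 2 / 3) : ℝ) : S1) = s3 ((m + -(t / 2) : ℝ) : S1) :=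
    s3_eq_of_eq 2 (by push_cast; ring)
  have e2 : s3 ((m + (t / 2 + 1 / 3) : ℝ) : S1) = s3 ((m + t / 2 : ℝ) : S1) :=
    s3_eq_of_eq 1 (by push_cast; ring)
  have hM : (((m + (-(t / 2) + 2 / 3) : ℝ) : S1), ((m + (t / 2 + 1 / 3) : ℝ) : S1)) ∈ R := by
    refine hR.pull _ (mem_compat_of_arc (I := (1 / 3 + t / 2, 2 / 3 - t / 2))
      (by simp [arcBounds]) (mem_arc (by linarith) (by linarith))
      (mem_arc (by linarith) (by linarith))) ?_
    dsimp only
    rw [e1, e2]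
    exact hR.fwd _ hR.base
  have hlen : |1 / 3 - chordLen s(((m + (-(t / 2) + 2 / 3) : ℝ) : S1),
      ((m + (t / 2 + 1 / 3) : ℝ) : S1))| = t := by
    rw [chordLen_mk, ← AddCircle.coe_sub,
      show m + (-(t / 2) + 2 / 3) - (m + (t / 2 + 1 / 3)) = 1 / 3 - t by ring,
      norm_coe_of_nonneg (by linarith) (by linarith), sub_sub_cancel, abs_of_pos h0]
  refine ⟨Or.inl ?_, fun _ => ⟨_, hR.base, rfl⟩, ⟨_, ⟨⟨_, hM, rfl⟩, ?_⟩, ?_⟩, ?_⟩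
  · rw [chordLen_mk, norm_sub_rev, ← AddCircle.coe_sub,
      show m + t / 2 - (m + -(t / 2)) = t by ring, norm_coe_of_nonneg (by linarith) (by linarith)]
    exact h1
  · rintro _ ⟨z, hz, rfl⟩
    rw [hlen]
    exact (le_abs_sub_norm_of_mem_compat h0 h1 (hR.sub hz)).1
  · rw [cmap_mk, cmap_mk, e1, e2]
  · rintro _ ⟨⟨⟨x, y⟩, hz, rfl⟩, hmax⟩
    have hle := hmax _ ⟨_, hM, rfl⟩
    rw [hlen] at hle
    obtain ⟨θ, ⟨h2, h3⟩, φ, ⟨h4, h5⟩, rfl, rfl⟩ :=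
      (le_abs_sub_norm_of_mem_compat h0 h1 (hR.sub hz)).2 hle
    apply disjoint_of_crossForm_pos
    apply crossForm_pos_of_lt <;> linarith

end IsSaturated

lemma IsLegalPair.exists_lamination {c : Chord} (h : IsLegalPair c) :
    ∃ L, IsCubicSymLam L ∧ IsComajor L c := by
  rcases h with h | ⟨a, t, h0, h1, -, hc, hcross, hstrip⟩
  · induction c using Sym2.ind with
    | _ x y =>
      obtain rfl : x = y := h
      exact exists_lamination_of_isDiag x
  · have hc' : c = s(((a + t / 2 + -(t / 2) : ℝ) : S1), ((a + t / 2 + t / 2 : ℝ) : S1)) := by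
      rw [hc, add_neg_cancel_right, add_assoc, add_halves]
    obtain ⟨R, hR⟩ := (isGood_orbitPairs h0 h1 hc hcross hstrip).exists_isSaturated h0 h1
      ⟨0, Or.inl (by rw [cmap_iterate_zero, hc'])⟩
    refine ⟨chordsOf R, hR.isCubicSymLam h0 h1, ?_⟩
    rw [hc']
    exact hR.isComajor h0 h1

theorem comajor_pair_iff_legal :
    ∀ c : Chord,
      (∃ L : Set Chord, IsCubicSymLam L ∧ IsComajor L c ∧ IsComajor L (cmap antip c)) ↔
      IsLegalPair c := by
  intro c
  constructor
  · rintro ⟨L, hL, hc, -⟩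
    exact isLegalPair_of_isComajor hL hc
  · intro h
    obtain ⟨L, hL, hc⟩ := h.exists_lamination
    exact ⟨L, hL, hc, hc.antip hL.symm⟩

end
end

section
/- A periodic leaf of a cubic symmetric lamination cannot have one endpoint of type B and one endpoint of type D: if ℓ = {x, y} is a leaf of a cubic symmetric lamination L with both x and y periodic under s3, then it is impossible that x has period 2n with s3^n(x) = −x while y does not satisfy s3^m(y) = −y for m equal to half its period (i.e. x is of type B and y is of type D). -/
noncomputable section

open Set Metric

/-- The representative in `[0, 1)` of a point of the circle. -/
def unitRep (z : S1) : ℝ := (AddCircle.equivIco 1 0 z : Set.Ico (0:ℝ) (0+1))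

lemma coe_unitRep (z : S1) : ((unitRep z : ℝ) : S1) = z :=
  (AddCircle.equivIco 1 0).symm_apply_apply z

lemma unitRep_nonneg (z : S1) : 0 ≤ unitRep z :=
  (AddCircle.equivIco 1 0 z).2.1

lemma unitRep_lt_one (z : S1) : unitRep z < 1 :=
  (AddCircle.equivIco 1 0 z).2.2.trans_eq (zero_add 1)

lemma unitRep_injective : Function.Injective unitRep := fun z w h => by
  rw [← coe_unitRep z, h, coe_unitRep]

lemma unitRep_zero : unitRep 0 = 0 := by
  have h := AddCircle.coe_equivIco_mk_apply (p := (1:ℝ)) 0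
  simpa [unitRep] using h

/-- A point is one of the three `σ₃`-preimages of its image, in terms of representatives. -/
lemma unitRep_eq_div_three (z : S1) :
    ∃ i : ℤ, 0 ≤ i ∧ i ≤ 2 ∧ unitRep z = (i + unitRep (s3 z)) / 3 := by
  have h : ((3 * unitRep z : ℝ) : S1) = ((unitRep (s3 z) : ℝ) : S1) := by
    have h3 : ((3 : ℕ) • unitRep z : ℝ) = 3 * unitRep z := by simp
    rw [coe_unitRep, ← h3, AddCircle.coe_nsmul, coe_unitRep, s3]
  have h0 : ((3 * unitRep z - unitRep (s3 z) : ℝ) : S1) = 0 := by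
    rw [AddCircle.coe_sub, h, sub_self]
  obtain ⟨i, hi⟩ := (AddCircle.coe_eq_zero_iff (1:ℝ)).1 h0
  rw [zsmul_eq_mul, mul_one] at hi
  have z0 := unitRep_nonneg z
  have z1 := unitRep_lt_one z
  have w0 := unitRep_nonneg (s3 z)
  have w1 := unitRep_lt_one (s3 z)
  have lo : (-1 : ℝ) < i := by linarith
  have hi3 : (i : ℝ) < 3 := by linarith
  have lo' : -1 < i := by exact_mod_cast lo
  have hi3' : i < 3 := by exact_mod_cast hi3
  exact ⟨i, by omega, by omega, by linarith⟩

lemma s3_sub (a b : S1) : s3 (a - b) = s3 a - s3 b := nsmul_sub a b 3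

lemma not_disjoint_chordSet {ℓ₁ ℓ₂ : Chord} {e : S1} (h₁ : e ∈ ℓ₁) (h₂ : e ∈ ℓ₂) :
    ¬ Disjoint (chordSet ℓ₁) (chordSet ℓ₂) := by
  have key : ∀ ℓ : Chord, e ∈ ℓ → toC e ∈ chordSet ℓ := by
    intro ℓ h
    obtain ⟨f, rfl⟩ := h
    exact left_mem_segment ℝ _ _
  exact Set.not_disjoint_iff.2 ⟨_, key _ h₁, key _ h₂⟩

lemma exists_endpoints_of_cmap_eq {ℓ : Chord} {u v : S1} (h : cmap s3 ℓ = s(u, v)) :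
    ∃ p q, ℓ = s(p, q) ∧ s3 p = u ∧ s3 q = v := by
  induction ℓ using Sym2.ind with
  | _ p q =>
    rcases Sym2.eq_iff.1 h with ⟨h₁, h₂⟩ | ⟨h₁, h₂⟩
    · exact ⟨p, q, rfl, h₁, h₂⟩
    · exact ⟨q, p, Sym2.eq_swap, h₂, h₁⟩

/-- Two chords cross as soon as, measured from `x`, their endpoints alternate. -/
lemma crosses_of_unitRep {x a p q : S1} (h₁ : 0 < unitRep (q - x))
    (h₂ : unitRep (q - x) < unitRep (a - x)) (h₃ : unitRep (a - x) < unitRep (p - x)) :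
    Crosses s(x, a) s(p, q) := by
  have lift : ∀ z : S1, ((unitRep x + unitRep (z - x) : ℝ) : S1) = z := fun z => by
    rw [AddCircle.coe_add, coe_unitRep, coe_unitRep, add_sub_cancel]
  have := unitRep_lt_one (p - x)
  refine Or.inl ⟨unitRep x, unitRep x + unitRep (q - x), unitRep x + unitRep (a - x),
    unitRep x + unitRep (p - x), by linarith, by linarith, by linarith, by linarith, ?_, ?_⟩
  · rw [lift, coe_unitRep]
  · rw [lift, lift, Sym2.eq_swap]

/-- On the leaves of an invariant lamination issuing from a common point, the tripling map
preserves the order of the other endpoints, when the images are distinct. -/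
lemma unitRep_s3_lt {L : Set Chord} (hL : IsInvLam L) {x a b : S1}
    (ha : s(x, a) ∈ L) (hb : s(x, b) ∈ L)
    (hxb : s3 x ≠ s3 b) (hab : s3 a ≠ s3 b)
    (h : unitRep (a - x) < unitRep (b - x)) :
    unitRep (s3 a - s3 x) < unitRep (s3 b - s3 x) := by
  by_contra hlt
  have hne : unitRep (s3 a - s3 x) ≠ unitRep (s3 b - s3 x) := fun e =>
    hab (sub_left_injective (unitRep_injective e))
  have hvu : unitRep (s3 b - s3 x) < unitRep (s3 a - s3 x) :=
    lt_of_le_of_ne (not_lt.1 hlt) hne.symm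
  have hv : 0 < unitRep (s3 b - s3 x) := by
    refine lt_of_le_of_ne (unitRep_nonneg _) fun e => hxb ?_
    rw [← unitRep_zero] at e
    exact (sub_eq_zero.1 (unitRep_injective e).symm).symm
  have hu := unitRep_lt_one (s3 a - s3 x)
  obtain ⟨i, hi0, hi2, hi⟩ := unitRep_eq_div_three (a - x)
  obtain ⟨j, hj0, hj2, hj⟩ := unitRep_eq_div_three (b - x)
  rw [s3_sub] at hi hj
  have hij : i < j := by
    have : (i : ℝ) < j := by linarith
    exact_mod_cast this
  -- a sibling joins the `k`-th preimage of `s3 x` to the `m`-th preimage of `s3 b`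
  have sib : ∀ ℓ : Chord, cmap s3 ℓ = cmap s3 s(x, b) → Disjoint (chordSet s(x, b)) (chordSet ℓ) →
      ∃ p q : S1, ∃ k m : ℤ, ℓ = s(p, q) ∧ 1 ≤ k ∧ k ≤ 2 ∧ 0 ≤ m ∧ m ≤ 2 ∧ m ≠ j ∧
        unitRep (p - x) = k / 3 ∧ unitRep (q - x) = (m + unitRep (s3 b - s3 x)) / 3 := by
    intro ℓ hℓ hd
    obtain ⟨p, q, rfl, hp, hq⟩ := exists_endpoints_of_cmap_eq (u := s3 x) (v := s3 b) hℓ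
    obtain ⟨k, hk0, hk2, hk⟩ := unitRep_eq_div_three (p - x)
    obtain ⟨m, hm0, hm2, hm⟩ := unitRep_eq_div_three (q - x)
    rw [s3_sub, hp, sub_self, unitRep_zero, add_zero] at hk
    rw [s3_sub, hq] at hm
    have hk1 : k ≠ 0 := by
      rintro rfl
      have e : unitRep (p - x) = unitRep 0 := by rw [hk, unitRep_zero]; simp
      have e' : p = x := sub_eq_zero.1 (unitRep_injective e)
      exact not_disjoint_chordSet (e := x) (by simp) (by simp [e']) hd
    have hmj : m ≠ j := by
      rintro rfl
      have e' : q = b := sub_left_injective (unitRep_injective (hm.trans hj.symm))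
      exact not_disjoint_chordSet (e := b) (by simp) (by simp [e']) hd
    exact ⟨p, q, k, m, rfl, by omega, hk2, hm0, hm2, hmj, hk, hm⟩
  have noCross : ∀ (p q : S1) (k m : ℤ), s(p, q) ∈ L → 0 ≤ m → unitRep (p - x) = k / 3 →
      unitRep (q - x) = (m + unitRep (s3 b - s3 x)) / 3 → m ≤ i → ¬ i < k := by
    intro p q k m hpq hm0 hk hm hmi hik
    have hm0' : (0 : ℝ) ≤ m := by exact_mod_cast hm0
    have hmi' : (m : ℝ) ≤ i := by exact_mod_cast hmi
    have hik' : (i : ℝ) + 1 ≤ k := by exact_mod_cast hik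
    exact hL.nocross _ ha _ hpq
      (crosses_of_unitRep (by linarith) (by linarith) (by linarith))
  have hnd : ¬ (cmap s3 s(x, b)).IsDiag := hxb
  obtain ⟨ℓ₂, h₂, ℓ₃, h₃, d₁₂, d₁₃, d₂₃, -, e₂, e₃⟩ := hL.siblings _ hb hnd
  obtain ⟨p, q, k, m, rfl, hk1, hk2, hm0, hm2, hmj, hk, hm⟩ := sib _ e₂ d₁₂
  obtain ⟨p', q', k', m', rfl, hk1', hk2', hm0', hm2', hmj', hk', hm'⟩ := sib _ e₃ d₁₃
  have hkk : k ≠ k' := by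
    rintro rfl
    have e : p = p' := sub_left_injective (unitRep_injective (hk.trans hk'.symm))
    exact not_disjoint_chordSet (e := p) (by simp) (by simp [e]) d₂₃
  have hmm : m ≠ m' := by
    rintro rfl
    have e : q = q' := sub_left_injective (unitRep_injective (hm.trans hm'.symm))
    exact not_disjoint_chordSet (e := q) (by simp) (by simp [e]) d₂₃
  have c := noCross p q k m h₂ hm0 hk hm
  have c' := noCross p' q' k' m' h₃ hm0' hk' hm'
  omega

lemma s3_injOn_periodicPts : Set.InjOn s3 (Function.periodicPts s3) := by
  rintro a ⟨m, hm, ha⟩ b ⟨n, hn, hb⟩ h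
  exact ha.eq_of_apply_eq hb hm hn h

lemma s3_mem_periodicPts {a : S1} (ha : a ∈ Function.periodicPts s3) :
    s3 a ∈ Function.periodicPts s3 := by
  obtain ⟨m, hm, h⟩ := ha
  exact ⟨m, hm, h.apply⟩

lemma iterate_s3_mem_periodicPts {a : S1} (ha : a ∈ Function.periodicPts s3) (n : ℕ) :
    s3^[n] a ∈ Function.periodicPts s3 := by
  induction n with
  | zero => exact ha
  | succ n ih => rw [Function.iterate_succ_apply']; exact s3_mem_periodicPts ih

lemma iterate_s3_injOn (n : ℕ) : Set.InjOn s3^[n] (Function.periodicPts s3) := by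
  induction n with
  | zero => exact fun _ _ _ _ h => h
  | succ n ih =>
    intro a ha b hb h
    rw [Function.iterate_succ_apply', Function.iterate_succ_apply'] at h
    exact ih ha hb (s3_injOn_periodicPts (iterate_s3_mem_periodicPts ha n)
      (iterate_s3_mem_periodicPts hb n) h)

lemma iterate_s3_leaf_mem {L : Set Chord} (hL : IsInvLam L) {x a : S1}
    (hx : x ∈ Function.periodicPts s3) (ha : a ∈ Function.periodicPts s3) (hxa : x ≠ a)
    (h : s(x, a) ∈ L) (n : ℕ) : s(s3^[n] x, s3^[n] a) ∈ L := by
  induction n with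
  | zero => exact h
  | succ n ih =>
    rw [Function.iterate_succ_apply', Function.iterate_succ_apply']
    refine (hL.forward _ ih).resolve_right fun hd => hxa ?_
    have hd' : s3 (s3^[n] x) = s3 (s3^[n] a) := hd
    exact iterate_s3_injOn (n + 1) hx ha (by simpa only [Function.iterate_succ_apply'] using hd')

lemma unitRep_iterate_s3_lt {L : Set Chord} (hL : IsInvLam L) {x a b : S1}
    (hx : x ∈ Function.periodicPts s3) (ha : a ∈ Function.periodicPts s3)
    (hb : b ∈ Function.periodicPts s3) (hxa : x ≠ a) (hxb : x ≠ b)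
    (hla : s(x, a) ∈ L) (hlb : s(x, b) ∈ L)
    (h : unitRep (a - x) < unitRep (b - x)) (n : ℕ) :
    unitRep (s3^[n] a - s3^[n] x) < unitRep (s3^[n] b - s3^[n] x) := by
  have hab : a ≠ b := by rintro rfl; exact lt_irrefl _ h
  induction n with
  | zero => exact h
  | succ n ih =>
    have inj := iterate_s3_injOn (n + 1)
    simp only [Function.iterate_succ_apply']
    refine unitRep_s3_lt hL (iterate_s3_leaf_mem hL hx ha hxa hla n)
      (iterate_s3_leaf_mem hL hx hb hxb hlb n) ?_ ?_ ih <;>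
      simp only [← Function.iterate_succ_apply' s3 n]
    · exact fun e => hxb (inj hx hb e)
    · exact fun e => hab (inj ha hb e)

lemma half_add_half : (((1:ℝ)/2 : ℝ) : S1) + (((1:ℝ)/2 : ℝ) : S1) = 0 := by
  rw [← AddCircle.coe_add, add_halves, AddCircle.coe_period]

lemma antip_ne (x : S1) : antip x ≠ x := by
  intro h
  have h0 : (((1:ℝ)/2 : ℝ) : S1) = 0 := by simpa [antip] using h
  obtain ⟨n, hn⟩ := (AddCircle.coe_eq_zero_iff (1:ℝ)).1 h0
  have h2 : (2 * n : ℝ) = 1 := by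
    rw [zsmul_eq_mul, mul_one] at hn; linarith
  have : 2 * n = 1 := by exact_mod_cast h2
  omega

lemma s3_commute_antip : Function.Commute s3 antip := by
  intro x
  have h3 : (3 : ℕ) • (((1:ℝ)/2 : ℝ) : S1) = (((1:ℝ)/2 : ℝ) : S1) := by
    rw [succ_nsmul, two_nsmul, half_add_half, zero_add]
  simp only [s3, antip, nsmul_add, h3]

lemma antip_sub_antip (a b : S1) : antip a - antip b = a - b := by
  simp [antip]

lemma antip_mem_periodicPts {a : S1} (ha : a ∈ Function.periodicPts s3) :
    antip a ∈ Function.periodicPts s3 := by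
  obtain ⟨m, hm, h⟩ := ha
  exact ⟨m, hm, h.map s3_commute_antip.symm⟩

/-- A point is of type B as soon as some iterate of `σ₃` sends it to its antipode. -/
lemma typeB_of_iterate_eq_antip {y : S1} {n : ℕ} (h : s3^[n] y = antip y) : TypeB y := by
  have h2 : Function.IsPeriodicPt s3 (2 * n) y := by
    change s3^[2 * n] y = y
    rw [two_mul, Function.iterate_add_apply, h, (s3_commute_antip.iterate_left n).eq, h,
      antip_antip]
  obtain ⟨k, hk⟩ := h2.minimalPeriod_dvd
  have hodd : ¬ Even k := by
    rintro ⟨l, rfl⟩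
    have hn : n = Function.minimalPeriod s3 y * l := by linarith
    have hp : Function.IsPeriodicPt s3 n y := by
      rw [hn]; exact (Function.isPeriodicPt_minimalPeriod s3 y).mul_const l
    exact antip_ne y (h.symm.trans hp)
  obtain ⟨l, rfl⟩ := Nat.not_even_iff_odd.1 hodd
  have hev : Even (Function.minimalPeriod s3 y) := by
    have : Even (Function.minimalPeriod s3 y * (2 * l + 1)) := ⟨n, by omega⟩
    rcases Nat.even_mul.1 this with h | h
    · exact h
    · exact absurd h hodd
  obtain ⟨m, hm⟩ := hev
  have hn : n = m + Function.minimalPeriod s3 y * l := by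
    rw [hm] at hk ⊢
    linarith
  have hmy : s3^[m] y = antip y := by
    rw [← h, hn, Function.iterate_add_apply,
      ((Function.isPeriodicPt_minimalPeriod s3 y).mul_const l).eq]
  refine ⟨m, ?_, by omega, hmy⟩
  rcases Nat.eq_zero_or_pos m with rfl | hm
  · exact absurd hmy.symm (antip_ne y)
  · exact hm

theorem no_mixed_type_periodic_leaf :
    ∀ (L : Set Chord) (x y : S1), IsCubicSymLam L → s(x, y) ∈ L →
      PerPt x → PerPt y → ¬ (TypeB x ∧ ¬ TypeB y) := by
  rintro L x y hL hxy hx hy ⟨⟨n, -, -, hnx⟩, hyB⟩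
  have hx' : x ∈ Function.periodicPts s3 := hx
  have hy' : y ∈ Function.periodicPts s3 := hy
  set g : S1 → S1 := fun z => antip (s3^[n] z) with hg
  have hgx : g x = x := by rw [hg]; simp only [hnx, antip_antip]
  -- `g` maps leaves from `x` to periodic points to such leaves, preserving their order
  set A : Set S1 := {a | a ∈ Function.periodicPts s3 ∧ x ≠ a ∧ s(x, a) ∈ L} with hA
  have hgA : ∀ a ∈ A, g a ∈ A := by
    rintro a ⟨ha, hxa, hla⟩
    refine ⟨antip_mem_periodicPts (iterate_s3_mem_periodicPts ha n), fun e => hxa ?_, ?_⟩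
    · rw [← hgx] at e
      have e' := congrArg antip e
      simp only [hg, antip_antip] at e'
      exact iterate_s3_injOn n hx' ha (by simpa only [hgx] using e')
    · have := hL.symm _ (iterate_s3_leaf_mem hL.toIsInvLam hx' ha hxa hla n)
      have e : cmap antip s(s3^[n] x, s3^[n] a) = s(g x, g a) := rfl
      rwa [e, hgx] at this
  have hglt : ∀ a ∈ A, ∀ b ∈ A, unitRep (a - x) < unitRep (b - x) →
      unitRep (g a - x) < unitRep (g b - x) := by
    rintro a ⟨ha, hxa, hla⟩ b ⟨hb, hxb, hlb⟩ h
    have := unitRep_iterate_s3_lt hL.toIsInvLam hx' ha hb hxa hxb hla hlb h n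
    rw [← antip_sub_antip, ← antip_sub_antip (s3^[n] b)] at this
    change unitRep (g a - g x) < unitRep (g b - g x) at this
    rwa [hgx] at this
  have hyA : y ∈ A := by
    refine ⟨hy', fun e => hyB (e ▸ typeB_of_iterate_eq_antip hnx), hxy⟩
  have hiter : ∀ k, g^[k] y ∈ A := fun k => by
    induction k with
    | zero => exact hyA
    | succ k ih => rw [Function.iterate_succ_apply']; exact hgA _ ih
  obtain ⟨q, hq, hqy⟩ := hy
  have hper : g^[2 * q] y = y := by
    have hanti : Function.IsPeriodicPt antip (2 * q) y :=
      Function.IsPeriodicPt.mul_const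
        (show Function.IsPeriodicPt antip 2 y from antip_antip y) q
    have hs3 : Function.IsPeriodicPt s3^[n] (2 * q) y :=
      Function.IsPeriodicPt.const_mul (Function.IsPeriodicPt.iterate hqy n) 2
    exact Function.IsPeriodicPt.comp (s3_commute_antip.iterate_left n).symm hanti hs3
  have hq0 : 0 < 2 * q := by omega
  rcases lt_trichotomy (unitRep (y - x)) (unitRep (g y - x)) with h | h | h
  · have hmono : StrictMono fun k => unitRep (g^[k] y - x) := by
      refine strictMono_nat_of_lt_succ fun k => ?_
      induction k with
      | zero => exact h
      | succ k ih =>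
        simp only [Function.iterate_succ_apply' g] at ih ⊢
        exact hglt _ (hiter k) _ (hgA _ (hiter k)) ih
    have := hmono hq0
    simp only [hper, Function.iterate_zero_apply] at this
    exact lt_irrefl _ this
  · have e : y = antip (s3^[n] y) := sub_left_injective (unitRep_injective h)
    refine hyB (typeB_of_iterate_eq_antip (n := n) ?_)
    rw [← antip_antip (s3^[n] y), ← e]
  · have hanti : StrictAnti fun k => unitRep (g^[k] y - x) := by
      refine strictAnti_nat_of_succ_lt fun k => ?_
      induction k with
      | zero => exact h
      | succ k ih =>
        simp only [Function.iterate_succ_apply' g] at ih ⊢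
        exact hglt _ (hgA _ (hiter k)) _ (hiter k) ih
    have := hanti hq0
    simp only [hper, Function.iterate_zero_apply] at this
    exact lt_irrefl _ this

end
end
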